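/- arXiv:math/0612749 — 10 statements merged into one kernel-verified Lean document; each statement's English description precedes it below -/
import Mathlib

section
/- For every integer N ≥ 5, define M(N) = 2N+3 if N ≡ -1 (mod 12); M(N) = 2N+1 if N ≡ 0, 1, 3, 5, 7, or 9 (mod 12); and M(N) = 2N if N ≡ 2, 4, 6, 8, or 10 (mod 12). Then there exist a constant c > 0 and a threshold n₀ such that for every integer n ≥ n₀ there exists a finite set S of n points in ℝ² with the property that no line of ℝ² contains more than N points of S, and the number of lines containing exactly N points of S is at least c · n^(log M(N) / log N). -/
/-- A line in the plane: a one-dimensional affine subspace of ℝ². -/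
def IsLine (l : AffineSubspace ℝ (ℝ × ℝ)) : Prop :=
  Module.finrank ℝ l.direction = 1

/-- The quantity `M(N)` of Theorem 1: `2N+3` if `N ≡ -1 (mod 12)`; `2N+1` if
`N ≡ 0, 1, 3, 5, 7, 9 (mod 12)`; and `2N` if `N ≡ 2, 4, 6, 8, 10 (mod 12)`. -/
def M (N : ℕ) : ℕ :=
  if N % 12 = 11 then 2 * N + 3
  else if N % 12 = 0 ∨ N % 12 = 1 ∨ N % 12 = 3 ∨ N % 12 = 5 ∨ N % 12 = 7 ∨ N % 12 = 9 then
    2 * N + 1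
  else 2 * N

/-- planar determinant -/
def det2 (p q : ℝ × ℝ) : ℝ := p.1 * q.2 - q.1 * p.2

theorem exists_generic : ∃ f : (Fin 6 → ℤ) →+ ℝ × ℝ, ∀ u v, det2 (f u) (f v) = 0 →
    ∀ i j, u i * v j = u j * v i := by
  have ht := transcendental_liouvilleNumber (m := 2) le_rfl
  set t := liouvilleNumber (2 : ℕ) with htdef
  refine ⟨⟨⟨fun u => (∑ i, (u i : ℝ) * t ^ (i : ℕ), ∑ i, (u i : ℝ) * t ^ (6 * (i : ℕ))), ?_⟩, ?_⟩, ?_⟩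
  · simp
  · intro u v
    simp [add_mul, Finset.sum_add_distrib]
  · intro u v h i j
    simp only [AddMonoidHom.coe_mk, ZeroHom.coe_mk, det2] at h
    set p : Polynomial ℤ := ∑ i : Fin 6, ∑ j : Fin 6,
      Polynomial.monomial ((i : ℕ) + 6 * (j : ℕ)) (u i * v j - v i * u j) with hp
    have h0 : Polynomial.aeval t p = 0 := by
      rw [← h, hp, Finset.sum_mul_sum, Finset.sum_mul_sum, ← Finset.sum_sub_distrib]
      simp only [map_sum, Polynomial.aeval_monomial, ← Finset.sum_sub_distrib]
      refine Finset.sum_congr rfl fun a _ => Finset.sum_congr rfl fun b _ => ?_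
      simp
      ring
    have h1 : p = 0 := by
      by_contra hne
      exact ht ⟨p, hne, h0⟩
    have h2 : p.coeff ((i : ℕ) + 6 * (j : ℕ)) = u i * v j - v i * u j := by
      rw [hp]
      simp only [Polynomial.finsetSum_coeff, Polynomial.coeff_monomial]
      rw [Finset.sum_eq_single i, Finset.sum_eq_single j]
      · simp
      · intro b _ hb
        rw [if_neg]
        intro h; apply hb; ext; omega
      · simp
      · intro b _ hb
        apply Finset.sum_eq_zero
        intro c _
        rw [if_neg]
        intro h; apply hb; ext; omega
      · simp
    rw [h1] at h2
    simp at h2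
    linarith

/-- squared norm -/
def qf (u : Fin 4 → ℤ) : ℤ := u 0 ^ 2 + u 1 ^ 2 + u 2 ^ 2 + u 3 ^ 2

/-- lifted point -/
def lift6 (B : ℤ) (u : Fin 4 → ℤ) (j : ℤ) : Fin 6 → ℤ :=
  ![u 0, u 1, u 2, u 3, qf u - j ^ 2 * B, j]

theorem lift6_key (B : ℤ) (u u' u'' : Fin 4 → ℤ) (j k : ℤ) (hne : u ≠ u')
    (h : ∀ a b, (lift6 B u' j - lift6 B u j) a * (lift6 B u'' k - lift6 B u j) b
      = (lift6 B u' j - lift6 B u j) b * (lift6 B u'' k - lift6 B u j) a) :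
    k = j ∧ (u'' = u ∨ u'' = u') := by
  obtain ⟨i, hi⟩ : ∃ i, u' i - u i ≠ 0 := by
    by_contra hc
    push Not at hc
    exact hne (funext fun i => by linarith [hc i])
  have e5 : ∀ a : Fin 4, (u' a - u a) * (k - j) = 0 := by
    intro a
    have := h a.castSucc.castSucc 5
    fin_cases a <;> simpa [lift6] using this
  have hk : k = j := by
    rcases mul_eq_zero.1 (e5 i) with h | h
    · exact absurd h hi
    · linarith
  subst hk
  refine ⟨rfl, ?_⟩
  have e4 : ∀ a : Fin 4, (u' a - u a) * (qf u'' - qf u) = (qf u' - qf u) * (u'' a - u a) := by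
    intro a
    have := h a.castSucc.castSucc 4
    fin_cases a <;> simpa [lift6] using this
  have e : ∀ a b : Fin 4, (u' a - u a) * (u'' b - u b) = (u' b - u b) * (u'' a - u a) := by
    intro a b
    have := h a.castSucc.castSucc b.castSucc.castSucc
    fin_cases a <;> fin_cases b <;> simpa [lift6] using this
  obtain ⟨x, hx⟩ : ∃ x : Fin 4 → ℤ, ∀ a, u' a = u a + x a := ⟨fun a => u' a - u a, by simp⟩
  obtain ⟨z, hz⟩ : ∃ z : Fin 4 → ℤ, ∀ a, u'' a = u a + z a := ⟨fun a => u'' a - u a, by simp⟩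
  simp only [hx, hz, qf, add_sub_cancel_left] at e e4 hi
  have hpos : 0 < x 0 ^ 2 + x 1 ^ 2 + x 2 ^ 2 + x 3 ^ 2 := by
    have h4 : 0 < x i ^ 2 := by positivity
    have : x i ^ 2 ≤ x 0 ^ 2 + x 1 ^ 2 + x 2 ^ 2 + x 3 ^ 2 := by
      fin_cases i <;> simp <;> nlinarith [sq_nonneg (x 0), sq_nonneg (x 1), sq_nonneg (x 2), sq_nonneg (x 3)]
    linarith
  have e6 : x i * (z 0 ^ 2 + z 1 ^ 2 + z 2 ^ 2 + z 3 ^ 2) =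
      z i * (x 0 ^ 2 + x 1 ^ 2 + x 2 ^ 2 + x 3 ^ 2) := by
    linear_combination e4 i - 2 * u 0 * e i 0 - 2 * u 1 * e i 1 - 2 * u 2 * e i 2 - 2 * u 3 * e i 3
  have e7 : z i * (x i - z i) * (x 0 ^ 2 + x 1 ^ 2 + x 2 ^ 2 + x 3 ^ 2) = 0 := by
    linear_combination -x i * e6 + (x i * z 0 + z i * x 0) * e i 0 + (x i * z 1 + z i * x 1) * e i 1
      + (x i * z 2 + z i * x 2) * e i 2 + (x i * z 3 + z i * x 3) * e i 3
  have e8 := (mul_eq_zero.1 e7).resolve_right hpos.ne'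
  rcases mul_eq_zero.1 e8 with h | h
  · left
    ext b
    have := e i b
    rw [h, mul_zero] at this
    rw [hz, (mul_eq_zero.1 this).resolve_left hi, add_zero]
  · right
    ext b
    have := e i b
    have hh : z i = x i := by linarith
    rw [hh, mul_comm (x b)] at this
    rw [hz, hx, mul_left_cancel₀ hi this]

theorem isLine_det {l : AffineSubspace ℝ (ℝ × ℝ)} (hl : IsLine l) {p q r : ℝ × ℝ}
    (hp : p ∈ l) (hq : q ∈ l) (hr : r ∈ l) : det2 (q - p) (r - p) = 0 := by
  obtain ⟨v, hv, hv'⟩ := finrank_eq_one_iff'.1 hl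
  obtain ⟨a, ha⟩ := hv' ⟨q - p, AffineSubspace.vsub_mem_direction hq hp⟩
  obtain ⟨b, hb⟩ := hv' ⟨r - p, AffineSubspace.vsub_mem_direction hr hp⟩
  have ha' : q - p = a • (v : ℝ × ℝ) := by rw [Subtype.ext_iff] at ha; exact ha.symm
  have hb' : r - p = b • (v : ℝ × ℝ) := by rw [Subtype.ext_iff] at hb; exact hb.symm
  rw [ha', hb']
  simp [det2]
  ring

theorem isLine_pair {p q : ℝ × ℝ} (h : p ≠ q) : IsLine line[ℝ, p, q] := by
  unfold IsLine
  rw [direction_affineSpan, vectorSpan_pair_rev]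
  exact finrank_span_singleton (by simpa [sub_eq_zero] using h.symm)

theorem isLine_eq {l : AffineSubspace ℝ (ℝ × ℝ)} (hl : IsLine l) {p q : ℝ × ℝ} (h : p ≠ q)
    (hp : p ∈ l) (hq : q ∈ l) : l = line[ℝ, p, q] := by
  have hle : line[ℝ, p, q] ≤ l := affineSpan_pair_le_of_mem_of_mem hp hq
  symm
  refine AffineSubspace.eq_of_direction_eq_of_nonempty_of_le ?_ ⟨p, left_mem_affineSpan_pair ℝ p q⟩ hle
  refine Submodule.eq_of_le_of_finrank_eq (AffineSubspace.direction_le hle) ?_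
  rw [hl, isLine_pair h]

/-- rich lines -/
def rich (N : ℕ) (S : Finset (ℝ × ℝ)) : Set (AffineSubspace ℝ (ℝ × ℝ)) :=
  {l | IsLine l ∧ ((l : Set (ℝ × ℝ)) ∩ ↑S).ncard = N}

theorem rich_eq {N : ℕ} (hN : 2 ≤ N) {S : Finset (ℝ × ℝ)} {l} (hl : l ∈ rich N S) :
    ∃ p ∈ S, ∃ q ∈ S, p ≠ q ∧ p ∈ l ∧ q ∈ l ∧ l = line[ℝ, p, q] := by
  obtain ⟨h1, h2⟩ := hl
  have : 1 < ((l : Set (ℝ × ℝ)) ∩ ↑S).ncard := by omega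
  obtain ⟨p, hp, q, hq, hpq⟩ := (Set.one_lt_ncard (S.finite_toSet.inter_of_right _)).1 this
  exact ⟨p, hp.2, q, hq.2, hpq, hp.1, hq.1, isLine_eq h1 hpq hp.1 hq.1⟩

theorem rich_finite {N : ℕ} (hN : 2 ≤ N) (S : Finset (ℝ × ℝ)) : (rich N S).Finite := by
  refine Set.Finite.subset (((S ×ˢ S).finite_toSet).image fun x => line[ℝ, x.1, x.2]) ?_
  intro l hl
  obtain ⟨p, hp, q, hq, _, _, _, h⟩ := rich_eq hN hl
  exact ⟨(p, q), by simp [hp, hq], h.symm⟩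

theorem exists_off (S : Finset (ℝ × ℝ)) : ∃ x : ℝ × ℝ, x ∉ S ∧
    ∀ p ∈ S, ∀ q ∈ S, p ≠ q → x ∉ line[ℝ, p, q] := by
  classical
  have h0 : MeasureTheory.volume ((S : Set (ℝ × ℝ)) ∪
      ⋃ x ∈ S.offDiag, (line[ℝ, x.1, x.2] : Set (ℝ × ℝ))) = 0 := by
    refine MeasureTheory.measure_union_null (S.finite_toSet.measure_zero _) ?_
    refine (MeasureTheory.measure_biUnion_null_iff (Finset.countable_toSet S.offDiag)).2 ?_
    intro x hx
    have hx' : x.1 ≠ x.2 := by simp at hx; exact hx.2.2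
    refine MeasureTheory.Measure.addHaar_affineSubspace _ _ ?_
    intro h
    have := isLine_pair hx'
    rw [h] at this
    rw [IsLine, AffineSubspace.direction_top, finrank_top] at this
    simp at this
  have : ((S : Set (ℝ × ℝ)) ∪
      ⋃ x ∈ S.offDiag, (line[ℝ, x.1, x.2] : Set (ℝ × ℝ))) ≠ Set.univ := by
    intro h
    rw [h] at h0
    simp at h0
  obtain ⟨x, hx⟩ := (Set.ne_univ_iff_exists_notMem _).1 this
  simp only [Set.mem_union, not_or, Set.mem_iUnion, not_exists] at hx
  refine ⟨x, hx.1, fun p hp q hq hpq => hx.2 (p, q) (by simp [hp, hq, hpq])⟩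

theorem pad_one {N : ℕ} (hN : 2 ≤ N) (S : Finset (ℝ × ℝ))
    (hS : ∀ l : AffineSubspace ℝ (ℝ × ℝ), IsLine l → ((l : Set (ℝ × ℝ)) ∩ ↑S).ncard ≤ N) :
    ∃ S' : Finset (ℝ × ℝ), S'.card = S.card + 1 ∧
    (∀ l : AffineSubspace ℝ (ℝ × ℝ), IsLine l → ((l : Set (ℝ × ℝ)) ∩ ↑S').ncard ≤ N) ∧
    (rich N S).ncard ≤ (rich N S').ncard := by
  classical
  obtain ⟨x, hx, hx'⟩ := exists_off S
  refine ⟨insert x S, Finset.card_insert_of_notMem hx, ?_, ?_⟩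
  · intro l hl
    by_cases hxl : x ∈ l
    · have h1 : ((l : Set (ℝ × ℝ)) ∩ ↑S).ncard ≤ 1 := by
        by_contra hc
        push Not at hc
        obtain ⟨p, hp, q, hq, hpq⟩ := (Set.one_lt_ncard (S.finite_toSet.inter_of_right _)).1 hc
        apply hx' p hp.2 q hq.2 hpq
        rw [← isLine_eq hl hpq hp.1 hq.1]
        exact hxl
      rw [Finset.coe_insert, Set.inter_insert_of_mem hxl]
      exact (Set.ncard_insert_le _ _).trans (by omega)
    · rw [Finset.coe_insert, Set.inter_insert_of_notMem hxl]
      exact hS l hl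
  · refine Set.ncard_le_ncard ?_ (rich_finite hN _)
    intro l hl
    obtain ⟨p, hp, q, hq, hpq, _, _, h⟩ := rich_eq hN hl
    have hxl : x ∉ l := by rw [h]; exact hx' p hp q hq hpq
    refine ⟨hl.1, ?_⟩
    rw [Finset.coe_insert, Set.inter_insert_of_notMem hxl]
    exact hl.2

theorem pad {N : ℕ} (hN : 2 ≤ N) (S : Finset (ℝ × ℝ))
    (hS : ∀ l : AffineSubspace ℝ (ℝ × ℝ), IsLine l → ((l : Set (ℝ × ℝ)) ∩ ↑S).ncard ≤ N) (k : ℕ) :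
    ∃ S' : Finset (ℝ × ℝ), S'.card = S.card + k ∧
    (∀ l : AffineSubspace ℝ (ℝ × ℝ), IsLine l → ((l : Set (ℝ × ℝ)) ∩ ↑S').ncard ≤ N) ∧
    (rich N S).ncard ≤ (rich N S').ncard := by
  induction k with
  | zero => exact ⟨S, rfl, hS, le_rfl⟩
  | succ k ih =>
    obtain ⟨S₁, h1, h2, h3⟩ := ih
    obtain ⟨S₂, h4, h5, h6⟩ := pad_one hN S₁ h2
    exact ⟨S₂, by omega, h5, h3.trans h6⟩

/-- integer box -/
noncomputable def box (K : ℕ) : Finset (Fin 4 → ℤ) := Fintype.piFinset fun _ => Finset.Ico 0 (K : ℤ)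

theorem card_box (K : ℕ) : (box K).card = K ^ 4 := by
  simp [box]

theorem mem_box {K : ℕ} {u : Fin 4 → ℤ} : u ∈ box K ↔ ∀ i, 0 ≤ u i ∧ u i < K := by
  simp [box]

theorem popular (R : ℕ) (hR : 1 ≤ R) :
    ∃ B : ℤ, R ^ 2 ≤ 4 * ((box R).filter fun w => qf w = B).card := by
  have := Finset.exists_le_card_fiber_of_nsmul_le_card_of_maps_to
    (s := box R) (t := Finset.Ico 0 (4 * (R : ℤ) ^ 2)) (f := qf) (b := ((R : ℚ) ^ 2 / 4)) ?_ ?_ ?_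
  · obtain ⟨B, _, hB⟩ := this
    refine ⟨B, ?_⟩
    have : (R : ℚ) ^ 2 ≤ 4 * (((box R).filter fun w => qf w = B).card : ℚ) := by linarith
    exact_mod_cast this
  · intro w hw
    rw [mem_box] at hw
    have h : ∀ i, w i ^ 2 < (R : ℤ) ^ 2 := fun i => by nlinarith [hw i]
    simp only [Finset.mem_Ico, qf]
    constructor
    · positivity
    · linarith [h 0, h 1, h 2, h 3]
  · refine ⟨0, ?_⟩
    simp
    positivity
  · rw [card_box]
    have : (Finset.Ico 0 (4 * (R : ℤ) ^ 2)).card = 4 * R ^ 2 := by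
      simp
      exact_mod_cast Int.toNat_natCast (4 * R ^ 2)
    simp only [this, nsmul_eq_mul]
    push_cast
    apply le_of_eq
    ring

theorem construct (N : ℕ) (hN : 3 ≤ N) (R : ℕ) (hR : 1 ≤ R) :
    ∃ S : Finset (ℝ × ℝ), S.card = N ^ 5 * R ^ 4 ∧
    (∀ l : AffineSubspace ℝ (ℝ × ℝ), IsLine l → ((l : Set (ℝ × ℝ)) ∩ ↑S).ncard ≤ N) ∧
    R ^ 6 ≤ 4 * (rich N S).ncard := by
  classical
  obtain ⟨f, hf⟩ := exists_generic
  obtain ⟨B, hB⟩ := popular R hR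
  have f0 : ∀ u, f u = 0 → u = 0 := by
    intro u hu
    ext i
    obtain ⟨k, hk⟩ : ∃ k : Fin 6, k ≠ i := exists_ne i
    have := hf u (Pi.single k 1) (by simp [hu, det2]) i k
    simpa [hk.symm] using this
  set g : (Fin 4 → ℤ) × ℕ → ℝ × ℝ := fun x => f (lift6 B x.1 x.2) with hg
  have ginj : Function.Injective g := by
    intro x y hxy
    have h1 : f (lift6 B x.1 x.2 - lift6 B y.1 y.2) = 0 := by
      rw [map_sub, sub_eq_zero]; exact hxy
    have h2 := sub_eq_zero.1 (f0 _ h1)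
    have h3 := fun i => congrFun h2 i
    have e0 := h3 0
    have e1 := h3 1
    have e2 := h3 2
    have e3 := h3 3
    have e5 := h3 5
    simp [lift6] at e0 e1 e2 e3 e5
    refine Prod.ext (funext fun i => ?_) e5
    fin_cases i <;> assumption
  have key : ∀ l, IsLine l → ∀ a b c : (Fin 4 → ℤ) × ℕ, g a ∈ l → g b ∈ l → g c ∈ l →
      a ≠ b → a.2 = b.2 → c = a ∨ c = b := by
    intro l hl a b c ha hb hc hab h2
    have hd := isLine_det hl ha hb hc
    simp only [hg, ← map_sub] at hd
    have hm := hf _ _ hd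
    obtain ⟨u, j⟩ := a
    obtain ⟨u', j'⟩ := b
    obtain ⟨u'', k⟩ := c
    simp only at h2
    subst h2
    have hne : u ≠ u' := fun h => hab (by rw [h])
    obtain ⟨h3, h4⟩ := lift6_key B u u' u'' j k hne hm
    have h3' : k = j := by exact_mod_cast h3
    subst h3'
    rcases h4 with h4 | h4 <;> simp [h4]
  set T := box (N * R) ×ˢ Finset.range N with hT
  set S := T.image g with hS
  have good : ∀ l : AffineSubspace ℝ (ℝ × ℝ), IsLine l → ((l : Set (ℝ × ℝ)) ∩ ↑S).ncard ≤ N := by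
    intro l hl
    by_cases hex : ∃ a b, g a ∈ l ∧ g b ∈ l ∧ a ≠ b ∧ a.2 = b.2
    · obtain ⟨a, b, ha, hb, hab, h2⟩ := hex
      have hsub : ((l : Set (ℝ × ℝ)) ∩ ↑S) ⊆ {g a, g b} := by
        rintro x ⟨hx, hxS⟩
        simp only [hS, Finset.coe_image] at hxS
        obtain ⟨c, _, rfl⟩ := hxS
        rcases key l hl a b c ha hb hx hab h2 with h | h <;> simp [h]
      have := Set.ncard_le_ncard hsub (Set.toFinite _)
      have := Set.ncard_insert_le (g a) {g b}
      rw [Set.ncard_singleton] at this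
      omega
    · push Not at hex
      have heq : ((l : Set (ℝ × ℝ)) ∩ ↑S) = ↑((T.filter fun a => g a ∈ l).image g) := by
        ext x
        simp only [hS, Finset.coe_image, Finset.coe_filter, Set.mem_inter_iff, Set.mem_image,
          SetLike.mem_coe, Set.mem_ofPred_eq]
        constructor
        · rintro ⟨hx, c, hc, rfl⟩
          exact ⟨c, ⟨hc, hx⟩, rfl⟩
        · rintro ⟨c, ⟨hc, hx⟩, rfl⟩
          exact ⟨hx, c, hc, rfl⟩
      rw [heq, Set.ncard_coe_finset]
      refine Finset.card_image_le.trans ?_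
      have := Finset.card_le_card_of_injOn (s := T.filter fun a => g a ∈ l) (t := Finset.range N)
        Prod.snd ?_ ?_
      · simpa using this
      · intro a ha
        simp [hT] at ha
        simpa using ha.1.2
      · intro a ha b hb h2
        by_contra hab
        simp at ha hb
        exact hex a b ha.2 hb.2 hab h2
  refine ⟨S, ?_, good, ?_⟩
  · rw [hS, Finset.card_image_of_injective _ ginj, hT, Finset.card_product, card_box]
    simp
    ring
  · set F := (box R).filter fun w => qf w = B with hF
    set L : (Fin 4 → ℤ) × (Fin 4 → ℤ) → AffineSubspace ℝ (ℝ × ℝ) :=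
      fun x => line[ℝ, g (x.1, 0), g (x.1 + x.2, 1)] with hL
    have hpt : ∀ y w : Fin 4 → ℤ, qf w = B → ∀ j : ℕ,
        g (y + (j : ℤ) • w, j) ∈ L (y, w) := by
      intro y w hw j
      have h1 : lift6 B (y + (j : ℤ) • w) j =
          lift6 B y 0 + j • (lift6 B (y + w) 1 - lift6 B y 0) := by
        rw [← hw]
        ext i
        fin_cases i <;> simp [lift6, qf]
        ring
      have h2 : g (y + (j : ℤ) • w, j) = AffineMap.lineMap (g (y, 0)) (g (y + w, 1)) (j : ℝ) := by
        simp only [hg, h1, map_add, map_nsmul, map_sub, AffineMap.lineMap_apply]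
        simp [Nat.cast_smul_eq_nsmul, add_comm]
      rw [h2]
      exact AffineMap.lineMap_mem_affineSpan_pair _ _ _
    have hline : ∀ y w, IsLine (L (y, w)) := by
      intro y w
      apply isLine_pair
      intro h
      have := ginj h
      simp at this
    have hrich : ∀ x ∈ box R ×ˢ F, L x ∈ rich N S := by
      rintro ⟨y, w⟩ hx
      simp only [Finset.mem_product, hF, Finset.mem_filter, mem_box] at hx
      obtain ⟨hy, hw, hwB⟩ := hx
      refine ⟨hline y w, le_antisymm (good _ (hline y w)) ?_⟩
      have hsub : (↑((Finset.range N).image fun j : ℕ => g (y + (j : ℤ) • w, j)) : Set (ℝ × ℝ)) ⊆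
          ((L (y, w) : Set (ℝ × ℝ)) ∩ ↑S) := by
        intro p hp
        simp only [Finset.coe_image, Set.mem_image, Finset.coe_range, Set.mem_Iio] at hp
        obtain ⟨j, hj, rfl⟩ := hp
        refine ⟨hpt y w hwB j, ?_⟩
        rw [hS, Finset.coe_image]
        refine ⟨_, ?_, rfl⟩
        simp only [hT, Finset.coe_product, Set.mem_prod, Finset.mem_coe, mem_box, Finset.mem_range]
        refine ⟨fun i => ?_, hj⟩
        have h1 := hy i
        have h2 := hw i
        have hj' : (j : ℤ) + 1 ≤ N := by exact_mod_cast hj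
        simp only [Pi.add_apply, Pi.smul_apply, smul_eq_mul]
        push_cast
        constructor
        · have := h1.1
          have := h2.1
          positivity
        · nlinarith [mul_le_mul_of_nonneg_right hj' (h1.1.trans h1.2.le),
            mul_le_mul_of_nonneg_left h2.2.le (Int.natCast_nonneg j)]
      have := Set.ncard_le_ncard hsub (S.finite_toSet.inter_of_right _)
      rw [Set.ncard_coe_finset, Finset.card_image_of_injective, Finset.card_range] at this
      · exact this
      · intro j k hjk
        have := ginj hjk
        simp at this
        exact this.2
    have hLinj : Set.InjOn L (↑(box R ×ˢ F) : Set _) := by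
      rintro ⟨y, w⟩ hx ⟨y', w'⟩ hx' heq
      simp only [Finset.coe_product, Set.mem_prod, Finset.mem_coe, hF, Finset.mem_filter] at hx hx'
      have hB1 := hx.2.2
      have hB2 := hx'.2.2
      have p0 := hpt y w hB1 0
      have p1 := hpt y w hB1 1
      have q0 := hpt y' w' hB2 0
      have q1 := hpt y' w' hB2 1
      rw [← heq] at q0 q1
      simp at p0 p1 q0 q1
      have e0 : y = y' := by
        by_contra hne
        have := key _ (hline y w) (y, 0) (y', 0) (y + w, 1) p0 q0 p1 (by simpa using hne) rfl
        simp at this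
      have e1 : y + w = y' + w' := by
        by_contra hne
        have := key _ (hline y w) (y + w, 1) (y' + w', 1) (y, 0) p1 q1 p0 (by simpa using hne) rfl
        simp at this
      subst e0
      simp at e1
      rw [e1]
    have hc : (box R ×ˢ F).card ≤ (rich N S).ncard := by
      have := Set.ncard_le_ncard (s := ↑((box R ×ˢ F).image L)) (t := rich N S) (by
        intro l hl
        rw [Finset.coe_image] at hl
        obtain ⟨x, hx, rfl⟩ := hl
        exact hrich x hx) (rich_finite (by omega) S)
      rwa [Set.ncard_coe_finset, Finset.card_image_of_injOn hLinj] at this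
    rw [Finset.card_product, card_box] at hc
    calc R ^ 6 = R ^ 4 * R ^ 2 := by ring
      _ ≤ R ^ 4 * (4 * F.card) := Nat.mul_le_mul_left _ hB
      _ = 4 * (R ^ 4 * F.card) := by ring
      _ ≤ _ := Nat.mul_le_mul_left _ hc

theorem M_sq_le (N : ℕ) (hN : 5 ≤ N) : M N ^ 2 ≤ N ^ 3 := by
  unfold M
  split_ifs with h1 h2
  · have : 11 ≤ N := by omega
    nlinarith [mul_le_mul this (le_refl (N ^ 2)) (by positivity) (by positivity)]
  · nlinarith [mul_le_mul hN (le_refl (N ^ 2)) (by positivity) (by positivity)]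
  · nlinarith [mul_le_mul hN (le_refl (N ^ 2)) (by positivity) (by positivity)]

theorem exponent_le (N : ℕ) (hN : 5 ≤ N) : Real.log (M N) / Real.log N ≤ 3 / 2 := by
  have hlog : 0 < Real.log N := Real.log_pos (by exact_mod_cast (by omega : 1 < N))
  have hM : 0 < M N := by
    unfold M
    split_ifs <;> omega
  rw [div_le_iff₀ hlog]
  have h1 : Real.log ((M N : ℝ) ^ 2) ≤ Real.log ((N : ℝ) ^ 3) := by
    apply Real.log_le_log
    · positivity
    · exact_mod_cast M_sq_le N hN
  rw [Real.log_pow, Real.log_pow] at h1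
  push_cast at h1
  linarith

/-- Theorem 1: for each `N ≥ 5`, `t_N^{(N+1)}(n) = Ω(n^{log_N M(N)})`: there are `n`-point
sets with no line of more than `N` points and at least `c · n^{log M(N)/log N}` lines of
exactly `N` points. -/
theorem orchard_lower_bound (N : ℕ) (hN : 5 ≤ N) :
    ∃ c : ℝ, 0 < c ∧ ∃ n₀ : ℕ, ∀ n : ℕ, n₀ ≤ n →
      ∃ S : Finset (ℝ × ℝ), S.card = n ∧
        (∀ l : AffineSubspace ℝ (ℝ × ℝ), IsLine l → ((l : Set (ℝ × ℝ)) ∩ ↑S).ncard ≤ N) ∧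
        c * (n : ℝ) ^ (Real.log (M N) / Real.log N) ≤
          ({l : AffineSubspace ℝ (ℝ × ℝ) |
              IsLine l ∧ ((l : Set (ℝ × ℝ)) ∩ ↑S).ncard = N}).ncard := by
  have hD : (0 : ℝ) < (N : ℝ) ^ 5 * 16 := by positivity
  refine ⟨(4 * ((N : ℝ) ^ 5 * 16) ^ (3 / 2 : ℝ))⁻¹, by positivity, N ^ 5, fun n hn => ?_⟩
  have hDn : 0 < N ^ 5 := by positivity
  set R := Nat.findGreatest (fun R => N ^ 5 * R ^ 4 ≤ n) n with hRdef
  have hn1 : 1 ≤ n := by omega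
  have hR1 : 1 ≤ R := Nat.le_findGreatest hn1 (by simpa using hn)
  have hR2 : N ^ 5 * R ^ 4 ≤ n :=
    Nat.findGreatest_spec (P := fun R => N ^ 5 * R ^ 4 ≤ n) hn1 (by simpa using hn)
  have hR3 : n < N ^ 5 * (R + 1) ^ 4 := by
    by_contra hc
    push Not at hc
    have hle : R + 1 ≤ n := by
      calc R + 1 ≤ (R + 1) ^ 4 := Nat.le_self_pow (by norm_num) _
        _ ≤ N ^ 5 * (R + 1) ^ 4 := Nat.le_mul_of_pos_left _ hDn
        _ ≤ n := hc
    have : R + 1 ≤ R := Nat.le_findGreatest (P := fun R => N ^ 5 * R ^ 4 ≤ n) hle hc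
    omega
  have hR4 : n ≤ N ^ 5 * 16 * R ^ 4 := by
    calc n ≤ N ^ 5 * (R + 1) ^ 4 := hR3.le
      _ ≤ N ^ 5 * (2 * R) ^ 4 := by gcongr; omega
      _ = _ := by ring
  obtain ⟨S₀, h1, h2, h3⟩ := construct N (by omega) R hR1
  obtain ⟨S, h4, h5, h6⟩ := pad (N := N) (by omega) S₀ h2 (n - N ^ 5 * R ^ 4)
  refine ⟨S, by omega, h5, ?_⟩
  have h7 : (R : ℝ) ^ 6 ≤ 4 * ((rich N S).ncard : ℝ) := by
    exact_mod_cast h3.trans (Nat.mul_le_mul_left 4 h6)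
  have h8 : (n : ℝ) ^ (Real.log (M N) / Real.log N) ≤
      ((N : ℝ) ^ 5 * 16) ^ (3 / 2 : ℝ) * (R : ℝ) ^ 6 := by
    calc (n : ℝ) ^ (Real.log (M N) / Real.log N) ≤ (n : ℝ) ^ (3 / 2 : ℝ) :=
          Real.rpow_le_rpow_of_exponent_le (by exact_mod_cast hn1) (exponent_le N hN)
      _ ≤ ((N : ℝ) ^ 5 * 16 * (R : ℝ) ^ 4) ^ (3 / 2 : ℝ) := by
          apply Real.rpow_le_rpow (by positivity) _ (by norm_num)
          exact_mod_cast hR4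
      _ = ((N : ℝ) ^ 5 * 16) ^ (3 / 2 : ℝ) * ((R : ℝ) ^ 4) ^ (3 / 2 : ℝ) :=
          Real.mul_rpow (by positivity) (by positivity)
      _ = _ := by
          congr 1
          rw [← Real.rpow_natCast, ← Real.rpow_mul (by positivity), ← Real.rpow_natCast]
          norm_num
  change _ ≤ ((rich N S).ncard : ℝ)
  rw [inv_mul_le_iff₀ (by positivity)]
  have h9 : 0 < ((N : ℝ) ^ 5 * 16) ^ (3 / 2 : ℝ) := by positivity
  nlinarith [mul_le_mul_of_nonneg_left h7 h9.le]
end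

section
/- There exists a set S of 16 points in ℝ² such that there are at least 15 distinct lines each containing exactly 4 points of S. -/
/-- Elements `a + b t` of the ring `ℤ[t]`, with `t = (√5 - 1)/2`, so `t² = 1 - t`. -/
abbrev GoldZ := ℤ × ℤ

def gmul (x y : GoldZ) : GoldZ := (x.1 * y.1 + x.2 * y.2, x.1 * y.2 + x.2 * y.1 - x.2 * y.2)

noncomputable def gt : ℝ := (√5 - 1) / 2

lemma gt_sq : gt * gt = 1 - gt := by
  have h : √5 * √5 = (5 : ℝ) := Real.mul_self_sqrt (by norm_num)
  unfold gt
  linarith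

lemma gt_irr : Irrational gt := by
  have h : Irrational (√5) := by
    simpa using (Nat.Prime.irrational_sqrt (show Nat.Prime 5 by norm_num))
  unfold gt
  have := (h.sub_intCast 1).div_natCast (m := 2) (by norm_num)
  simpa using this

noncomputable def gev (x : GoldZ) : ℝ := x.1 + x.2 * gt

lemma gev_mul (x y : GoldZ) : gev (gmul x y) = gev x * gev y := by
  unfold gev gmul
  push_cast
  linear_combination (-(x.2 : ℝ) * y.2) * gt_sq

lemma gev_sub (x y : GoldZ) : gev (x - y) = gev x - gev y := by
  simp [gev]
  ring

lemma gev_eq_zero {x : GoldZ} (h : gev x = 0) : x = 0 := by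
  unfold gev at h
  have h2 : x.2 = 0 := by
    by_contra h2
    have := (gt_irr.intCast_mul h2).intCast_add x.1
    exact this.ne_zero h
  have h1 : x.1 = 0 := by
    rw [h2] at h
    simpa using h
  exact Prod.ext h1 h2

lemma gev_inj : Function.Injective gev := fun x y h =>
  sub_eq_zero.1 (gev_eq_zero (by rw [gev_sub, h, sub_self]))

abbrev GPt := GoldZ × GoldZ

noncomputable def gpt (p : GPt) : ℝ × ℝ := (gev p.1, gev p.2)

lemma gpt_inj : Function.Injective gpt := fun p q h =>
  Prod.ext (gev_inj (congrArg Prod.fst h)) (gev_inj (congrArg Prod.snd h))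

/-- The cross product detecting collinearity of three points. -/
def gcross (p q r : GPt) : GoldZ :=
  gmul (q.1 - p.1) (r.2 - p.2) - gmul (q.2 - p.2) (r.1 - p.1)

noncomputable def gline (pq : GPt × GPt) : AffineSubspace ℝ (ℝ × ℝ) :=
  AffineSubspace.mk' (gpt pq.1) (Submodule.span ℝ {gpt pq.2 - gpt pq.1})

lemma mem_gline {p q : GPt} (hpq : p ≠ q) (r : GPt) :
    gpt r ∈ gline (p, q) ↔ gcross p q r = 0 := by
  have key : gcross p q r = 0 ↔
      (gev q.1 - gev p.1) * (gev r.2 - gev p.2) - (gev q.2 - gev p.2) * (gev r.1 - gev p.1) = 0 := by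
    rw [← gev_sub, ← gev_sub, ← gev_sub, ← gev_sub, ← gev_mul, ← gev_mul, ← gev_sub]
    refine ⟨fun h => ?_, fun h => gev_eq_zero h⟩
    change gev (gcross p q r) = 0
    rw [h]
    simp [gev]
  rw [key, gline, AffineSubspace.mem_mk', Submodule.mem_span_singleton]
  simp only [gpt, vsub_eq_sub, Prod.mk_sub_mk, Prod.smul_mk, smul_eq_mul, Prod.mk.injEq]
  constructor
  · rintro ⟨a, h1, h2⟩
    rw [← h1, ← h2]
    ring
  · intro h
    by_cases h1 : gev q.1 - gev p.1 = 0
    · have h2 : gev q.2 - gev p.2 ≠ 0 := fun h2 => hpq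
        (Prod.ext (gev_inj (sub_eq_zero.1 h1)).symm (gev_inj (sub_eq_zero.1 h2)).symm)
      refine ⟨(gev r.2 - gev p.2) / (gev q.2 - gev p.2), ?_, by field_simp⟩
      rw [h1] at h ⊢
      have : gev r.1 - gev p.1 = 0 := by
        have h' : (gev q.2 - gev p.2) * (gev r.1 - gev p.1) = 0 := by linarith
        exact (mul_eq_zero.1 h').resolve_left h2
      rw [this, mul_zero]
    · refine ⟨(gev r.1 - gev p.1) / (gev q.1 - gev p.1), by field_simp, ?_⟩
      field_simp
      linarith

lemma isLine_gline {p q : GPt} (hpq : p ≠ q) : IsLine (gline (p, q)) := by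
  unfold IsLine gline
  rw [AffineSubspace.direction_mk']
  exact finrank_span_singleton (sub_ne_zero.2 fun h => hpq (gpt_inj h).symm)

/-- Vertices of an affinely regular pentagon. -/
def pent : Fin 5 → GPt :=
  ![((1, 0), (0, 0)), ((0, 0), (1, 0)), ((-1, 0), (0, 1)), ((0, -1), (0, -1)), ((0, 1), (-1, 0))]

def gscale (c : GoldZ) (p : GPt) : GPt := (gmul c p.1, gmul c p.2)

/-- The pentagon of intersection points of the diagonals: scaling by `-t²`. -/
def pent' (k : Fin 5) : GPt := gscale (-1, 1) (pent k)

/-- The third nested pentagon: scaling by `t⁴`. -/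
def pent'' (k : Fin 5) : GPt := gscale (2, -3) (pent k)

def pts : Finset GPt :=
  {0} ∪ Finset.univ.image pent ∪ Finset.univ.image pent' ∪ Finset.univ.image pent''

/-- Pairs of points spanning the fifteen lines. -/
def prs : Finset (GPt × GPt) :=
  Finset.univ.image (fun k => (pent k, pent (k + 2))) ∪
    Finset.univ.image (fun k => (pent' k, pent' (k + 2))) ∪
    Finset.univ.image (fun k => (0, pent k))

def onLine (pq : GPt × GPt) : Finset GPt := pts.filter fun r => gcross pq.1 pq.2 r = 0

lemma prs_ne : ∀ pq ∈ prs, pq.1 ≠ pq.2 := by decide +kernel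

lemma prs_card : prs.card = 15 := by decide +kernel

lemma pts_card : pts.card = 16 := by decide +kernel

lemma onLine_card : ∀ pq ∈ prs, (onLine pq).card = 4 := by decide +kernel

lemma onLine_inj : ∀ a ∈ prs, ∀ b ∈ prs, onLine a = onLine b → a = b := by decide +kernel

lemma mem_onLine {pq : GPt × GPt} (h : pq ∈ prs) (r : GPt) :
    r ∈ onLine pq ↔ r ∈ pts ∧ gpt r ∈ gline pq := by
  rw [onLine, Finset.mem_filter, ← mem_gline (prs_ne pq h)]

/-- There exists a set `S` of 16 points in ℝ² such that there are at least 15 distinct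
lines each containing exactly 4 points of `S`. -/
theorem sixteen_points_fifteen_lines_of_four :
    ∃ S : Finset (ℝ × ℝ), S.card = 16 ∧
      ∃ L : Finset (AffineSubspace ℝ (ℝ × ℝ)), 15 ≤ L.card ∧
        ∀ l ∈ L, IsLine l ∧ ((l : Set (ℝ × ℝ)) ∩ ↑S).ncard = 4 := by
  classical
  refine ⟨pts.image gpt, by rw [Finset.card_image_of_injective _ gpt_inj, pts_card],
    prs.image gline, ?_, ?_⟩
  · rw [Finset.card_image_of_injOn, prs_card]
    intro a ha b hb hab
    refine onLine_inj a ha b hb (Finset.ext fun r => ?_)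
    rw [mem_onLine ha, mem_onLine hb, hab]
  · intro l hl
    obtain ⟨pq, h, rfl⟩ := Finset.mem_image.1 hl
    refine ⟨isLine_gline (prs_ne pq h), ?_⟩
    have : ((gline pq : Set (ℝ × ℝ)) ∩ ↑(pts.image gpt)) = ↑((onLine pq).image gpt) := by
      ext x
      simp only [Set.mem_inter_iff, SetLike.mem_coe, Finset.coe_image, Set.mem_image,
        Finset.mem_coe, mem_onLine h]
      constructor
      · rintro ⟨hx, r, hr, rfl⟩
        exact ⟨r, ⟨hr, hx⟩, rfl⟩
      · rintro ⟨r, ⟨hr, hx⟩, rfl⟩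
        exact ⟨hx, r, hr, rfl⟩
    rw [this, Set.ncard_coe_finset, Finset.card_image_of_injective _ gpt_inj, onLine_card pq h]
end

section
/- For every even integer n ≥ 4 there exists a set S of n² points in ℝ² such that there are at least 3n+3 distinct lines each containing exactly n points of S. (Such a configuration is obtained from two nested (n+1)-point stars, each formed from the longest diagonals of a regular (n+1)-gon.) -/
noncomputable def starAngle (h i : ℕ) : ℝ := 2 * Real.pi * i / (2 * h + 1)

noncomputable def starX (h : ℕ) : ℝ := Real.pi / (2 * (2 * h + 1))

lemma starX_pos (h : ℕ) : 0 < starX h := by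
  unfold starX; positivity

lemma starX_mul (h : ℕ) : (2 * h + 1) * starX h = Real.pi / 2 := by
  unfold starX; field_simp

lemma starAngle_eq (h i : ℕ) : starAngle h i = 4 * i * starX h := by
  unfold starX starAngle; field_simp; ring

lemma star_sin_lt (h a b : ℕ) (hab : a < b) (hb : b ≤ 2 * h + 1) :
    Real.sin (a * starX h) < Real.sin (b * starX h) := by
  have h0 := starX_pos h
  have h1 := starX_mul h
  have hab' : (a : ℝ) < b := by exact_mod_cast hab
  have hb' : (b : ℝ) ≤ 2 * h + 1 := by exact_mod_cast hb
  have hpi := Real.pi_pos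
  apply Real.sin_lt_sin_of_lt_of_le_pi_div_two
  · have : 0 ≤ (a : ℝ) * starX h := by positivity
    linarith
  · rw [← h1]; gcongr
  · gcongr

lemma star_sin_pos (h a : ℕ) (ha : 0 < a) (hb : a ≤ 2 * h + 1) :
    0 < Real.sin (a * starX h) := by
  simpa using star_sin_lt h 0 a ha hb

/-- the odd index governing the size of the cosine -/
def starIdx (h e : ℕ) : ℕ := (2 * (h : ℤ) + 1 - 4 * e).natAbs

lemma star_abs_cos (h e : ℕ) (he : e ≤ h) :
    |Real.cos (starAngle h e)| = Real.sin (starIdx h e * starX h) := by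
  have h1 := starX_mul h
  have hle : starIdx h e ≤ 2 * h + 1 := by unfold starIdx; omega
  have hpos : 0 < starIdx h e := by unfold starIdx; omega
  have hp := star_sin_pos h _ hpos hle
  have h2 : Real.cos (starAngle h e) = Real.sin (((2 * (h : ℤ) + 1 - 4 * e : ℤ) : ℝ) * starX h) := by
    rw [← Real.cos_pi_div_two_sub, starAngle_eq, ← h1]
    congr 1; push_cast; ring
  rw [h2, ← abs_of_pos hp]
  unfold starIdx
  rcases Int.natAbs_eq (2 * (h : ℤ) + 1 - 4 * e) with hq | hq
  · conv_lhs => rw [hq]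
    simp only [Int.cast_natCast]
  · conv_lhs => rw [hq]
    simp only [Int.cast_natCast, Int.cast_neg, neg_mul, Real.sin_neg, abs_neg]

lemma star_numeric (h : ℕ) (hh : 2 ≤ h) :
    ∃ ρ : ℝ, ρ ≠ 0 ∧ |ρ| < 1 ∧ ∃ T : Finset ℝ, T.card = 2 * h - 1 ∧ (∀ t ∈ T, t ≠ 0) ∧
      1 ∉ T ∧ ρ ∉ T ∧ ∀ e : ℕ, 1 ≤ e → e ≤ h → Real.cos (starAngle h e) ≠ 0 ∧
        1 / Real.cos (starAngle h e) ∈ T ∧ ρ / Real.cos (starAngle h e) ∈ T := by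
  set c : ℕ → ℝ := fun e => Real.cos (starAngle h e) with hc
  have habs : ∀ e, e ≤ h → |c e| = Real.sin (starIdx h e * starX h) := fun e he =>
    star_abs_cos h e he
  have hidxle : ∀ e, e ≤ h → starIdx h e ≤ 2 * h + 1 := by
    intro e he; unfold starIdx; omega
  have hidxpos : ∀ e, e ≤ h → 0 < starIdx h e := by
    intro e he; unfold starIdx; omega
  have hcpos : ∀ e, e ≤ h → 0 < |c e| := by
    intro e he; rw [habs e he]; exact star_sin_pos h _ (hidxpos e he) (hidxle e he)
  have hc0 : ∀ e, e ≤ h → c e ≠ 0 := fun e he => abs_pos.mp (hcpos e he)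
  have hlt : ∀ e f, e ≤ h → f ≤ h → starIdx h e < starIdx h f → |c e| < |c f| := by
    intro e f he hf hef
    rw [habs e he, habs f hf]
    exact star_sin_lt h _ _ hef (hidxle f hf)
  have hclt1 : ∀ e, 1 ≤ e → e ≤ h → |c e| < 1 := by
    intro e h1 he
    have : |c e| < |c 0| := hlt e 0 he (by omega) (by unfold starIdx; omega)
    simpa [hc, starAngle] using this
  have hinj : ∀ e f, 1 ≤ e → e ≤ h → 1 ≤ f → f ≤ h → |c e| = |c f| → e = f := by
    intro e f he1 he hf1 hf hef
    by_contra hne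
    have : starIdx h e ≠ starIdx h f := by unfold starIdx; omega
    rcases lt_or_gt_of_ne this with h3 | h3
    · exact absurd hef (hlt e f he hf h3).ne
    · exact absurd hef (hlt f e hf he h3).ne'
  obtain ⟨e0, he01, he0, hi0⟩ : ∃ e0, 1 ≤ e0 ∧ e0 ≤ h ∧ starIdx h e0 = 1 :=
    ⟨(h + 1) / 2, by omega, by omega, by unfold starIdx; omega⟩
  have hih : starIdx h h = 2 * h - 1 := by unfold starIdx; omega
  have hmin : ∀ e, 1 ≤ e → e ≤ h → e ≠ e0 → |c e0| < |c e| := by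
    intro e h1 he hne
    apply hlt e0 e he0 he
    unfold starIdx at *; omega
  have hmax : ∀ e, 1 ≤ e → e ≤ h → e ≠ h → |c e| < |c h| := by
    intro e h1 he hne
    apply hlt e h he le_rfl
    unfold starIdx at *; omega
  have hprod : ∀ e, 1 ≤ e → e ≤ h → c e0 ≠ c h * c e := by
    intro e h1 he heq
    have heq' : |c e0| = |c h| * |c e| := by rw [heq, abs_mul]
    by_cases hee : e = e0
    · subst hee
      have := hclt1 h (by omega) le_rfl
      nlinarith [hcpos e he]
    · have h3 : 3 ≤ starIdx h e := by unfold starIdx at *; omega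
      have hs3 : Real.sin (3 * starX h) ≤ |c e| := by
        rw [habs e he]
        rcases h3.eq_or_lt with h4 | h4
        · rw [← h4]; norm_num
        · exact_mod_cast (star_sin_lt h 3 _ h4 (hidxle e he)).le
      have hch : |c h| = Real.cos (2 * starX h) := by
        rw [habs h le_rfl, hih, ← Real.cos_pi_div_two_sub, ← starX_mul h]
        congr 1
        rw [Nat.cast_sub (by omega)]; push_cast; ring
      have he0v : |c e0| = Real.sin (starX h) := by
        rw [habs e0 he0, hi0]; simp
      have h5 := star_sin_lt h 1 5 (by norm_num) (by omega)
      have h6 : 2 * Real.sin (3 * starX h) * Real.cos (2 * starX h)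
          = Real.sin (5 * starX h) + Real.sin (starX h) := by
        have a1 := Real.sin_add (3 * starX h) (2 * starX h)
        have a2 := Real.sin_sub (3 * starX h) (2 * starX h)
        have b1 : 3 * starX h + 2 * starX h = 5 * starX h := by ring
        have b2 : 3 * starX h - 2 * starX h = starX h := by ring
        rw [b1] at a1; rw [b2] at a2; linarith
      norm_num at h5
      have h7 := mul_le_mul_of_nonneg_left hs3 (hcpos h le_rfl).le
      rw [hch] at h7 heq'
      nlinarith
  have hρ1 : |c e0 / c h| < 1 := by
    rw [abs_div, div_lt_one (hcpos h le_rfl)]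
    apply hlt e0 h he0 le_rfl; omega
  have hρ0 : c e0 / c h ≠ 0 := div_ne_zero (hc0 e0 he0) (hc0 h le_rfl)
  set ρ := c e0 / c h with hρ
  set E := Finset.Icc 1 h with hE
  set R1 := E.image (fun e => 1 / c e) with hR1
  set R2 := E.image (fun e => ρ / c e) with hR2
  have hcinj : ∀ r : ℝ, r ≠ 0 → (E.image (fun e => r / c e)).card = h := by
    intro r hr
    rw [Finset.card_image_of_injOn]
    · simp [hE]
    · intro e he f hf hef
      simp only [hE, Finset.coe_Icc, Set.mem_Icc] at he hf
      apply hinj e f he.1 he.2 hf.1 hf.2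
      have h1 := hc0 e he.2
      have h2 := hc0 f hf.2
      simp only at hef
      rw [div_eq_div_iff h1 h2] at hef
      rw [mul_left_cancel₀ hr hef]
  have hint : R1 ∩ R2 = {1 / c h} := by
    ext t
    simp only [hR1, hR2, hE, Finset.mem_inter, Finset.mem_image, Finset.mem_Icc,
      Finset.mem_singleton]
    constructor
    · rintro ⟨⟨e, he, rfl⟩, f, hf, hef⟩
      have h1 := hc0 e he.2
      have h2 := hc0 f hf.2
      have h3 := hc0 h le_rfl
      have hq : c e0 * c e = c h * c f := by
        rw [hρ] at hef; field_simp at hef; linarith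
      by_cases h4 : e = h
      · rw [h4]
      · exfalso
        have h5 := hmax e he.1 he.2 h4
        have h6 : |c e0| ≤ |c f| := by
          by_cases h7 : f = e0
          · rw [h7]
          · exact (hmin f hf.1 hf.2 h7).le
        have h8 : |c e0| * |c e| = |c h| * |c f| := by rw [← abs_mul, hq, abs_mul]
        nlinarith [hcpos e0 he0, hcpos f hf.2, hcpos h le_rfl]
    · rintro rfl
      refine ⟨⟨h, ⟨by omega, le_rfl⟩, rfl⟩, e0, ⟨he01, he0⟩, ?_⟩
      have := hc0 e0 he0
      rw [hρ]; field_simp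
  refine ⟨ρ, hρ0, hρ1, R1 ∪ R2, ?_, ?_, ?_, ?_, ?_⟩
  · have := Finset.card_union_add_card_inter R1 R2
    rw [hint, hcinj 1 one_ne_zero, hcinj ρ hρ0] at this
    simp at this; omega
  · intro t ht
    simp only [hR1, hR2, hE, Finset.mem_union, Finset.mem_image, Finset.mem_Icc] at ht
    rcases ht with ⟨e, he, rfl⟩ | ⟨e, he, rfl⟩
    · exact div_ne_zero one_ne_zero (hc0 e he.2)
    · exact div_ne_zero hρ0 (hc0 e he.2)
  · intro ht
    simp only [hR1, hR2, hE, Finset.mem_union, Finset.mem_image, Finset.mem_Icc] at ht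
    rcases ht with ⟨e, he, h1⟩ | ⟨e, he, h1⟩
    · rw [div_eq_one_iff_eq (hc0 e he.2)] at h1
      have := hclt1 e he.1 he.2
      rw [← h1] at this; simp at this
    · rw [div_eq_one_iff_eq (hc0 e he.2), hρ, div_eq_iff (hc0 h le_rfl)] at h1
      exact hprod e he.1 he.2 (by rw [h1]; ring)
  · intro ht
    simp only [hR1, hR2, hE, Finset.mem_union, Finset.mem_image, Finset.mem_Icc] at ht
    rcases ht with ⟨e, he, h1⟩ | ⟨e, he, h1⟩
    · rw [div_eq_iff (hc0 e he.2)] at h1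
      have := hclt1 e he.1 he.2
      have h2 : |ρ| * |c e| = 1 := by rw [← abs_mul, ← h1]; simp
      nlinarith [hcpos e he.2, abs_nonneg ρ]
    · rw [div_eq_iff (hc0 e he.2)] at h1
      have := hclt1 e he.1 he.2
      have h2 : c e = 1 := mul_left_cancel₀ hρ0 (by linarith)
      rw [h2] at this; simp at this
  · intro e h1 he
    refine ⟨hc0 e he, ?_, ?_⟩
    · exact Finset.mem_union_left _ (Finset.mem_image.mpr ⟨e, by simp [hE, h1, he], rfl⟩)
    · exact Finset.mem_union_right _ (Finset.mem_image.mpr ⟨e, by simp [hE, h1, he], rfl⟩)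

lemma star_sin_diff (h i j : ℕ) (hi : i < 2 * h + 1) (hj : j < 2 * h + 1)
    (hs : Real.sin (starAngle h i - starAngle h j) = 0) : i = j := by
  rw [Real.sin_eq_zero_iff] at hs
  obtain ⟨k, hk⟩ := hs
  have h1 : ((k * (2 * h + 1) : ℤ) : ℝ) = ((2 * (i - j) : ℤ) : ℝ) := by
    unfold starAngle at hk
    have hp := Real.pi_pos
    field_simp at hk
    push_cast
    linarith
  have h2 : k * (2 * h + 1) = 2 * ((i : ℤ) - j) := by exact_mod_cast h1
  have h3 : (2 * (h : ℤ) + 1) ∣ (i : ℤ) - j := by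
    refine ⟨((i : ℤ) - j) - k * h, ?_⟩
    linear_combination (h : ℤ) * h2
  have h4 := Int.eq_zero_of_abs_lt_dvd h3 (by rw [abs_lt]; omega)
  omega

lemma star_cos_diff (h i j : ℕ) (hi : i < 2 * h + 1) (hj : j < 2 * h + 1) (hij : i ≠ j) :
    ∃ e : ℕ, 1 ≤ e ∧ e ≤ h ∧
      Real.cos (starAngle h i - starAngle h j) = Real.cos (starAngle h e) := by
  wlog hlt : j < i generalizing i j
  · obtain ⟨e, h1, h2, h3⟩ := this j i hj hi hij.symm (by omega)
    exact ⟨e, h1, h2, by rw [← h3, ← Real.cos_neg]; congr 1; ring⟩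
  by_cases hd : i - j ≤ h
  · refine ⟨i - j, by omega, hd, ?_⟩
    congr 1
    unfold starAngle
    rw [Nat.cast_sub hlt.le]; ring
  · refine ⟨2 * h + 1 - (i - j), by omega, by omega, ?_⟩
    rw [← Real.cos_two_pi_sub]
    congr 1
    unfold starAngle
    rw [Nat.cast_sub (by omega), Nat.cast_sub hlt.le]
    push_cast
    field_simp

/-- line with unit normal of angle `θ` and offset `r` -/
noncomputable def starLine (θ r : ℝ) : AffineSubspace ℝ (ℝ × ℝ) :=
  AffineSubspace.mk' (r * Real.cos θ, r * Real.sin θ)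
    (Submodule.span ℝ {((-Real.sin θ, Real.cos θ) : ℝ × ℝ)})

lemma starLine_isLine (θ r : ℝ) : IsLine (starLine θ r) := by
  unfold IsLine starLine
  rw [AffineSubspace.direction_mk']
  apply finrank_span_singleton
  intro h
  rw [Prod.mk_eq_zero] at h
  have := Real.sin_sq_add_cos_sq θ
  rw [h.2, neg_eq_zero.mp h.1] at this
  norm_num at this

lemma mem_starLine (θ r : ℝ) (p : ℝ × ℝ) :
    p ∈ starLine θ r ↔ p.1 * Real.cos θ + p.2 * Real.sin θ = r := by
  unfold starLine
  rw [AffineSubspace.mem_mk', Submodule.mem_span_singleton]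
  have hsc := Real.sin_sq_add_cos_sq θ
  obtain ⟨x, y⟩ := p
  simp only [vsub_eq_sub, Prod.smul_mk, smul_eq_mul, Prod.mk_sub_mk, Prod.mk.injEq]
  constructor
  · rintro ⟨a, h1, h2⟩
    linear_combination (-Real.cos θ) * h1 - Real.sin θ * h2 + r * hsc
  · intro hr
    refine ⟨-x * Real.sin θ + y * Real.cos θ, ?_, ?_⟩
    · linear_combination (-Real.cos θ) * hr + x * hsc
    · linear_combination (-Real.sin θ) * hr + y * hsc

/-- point at signed distance `t` in direction `θ` -/
noncomputable def starPt (θ t : ℝ) : ℝ × ℝ := (t * Real.cos θ, t * Real.sin θ)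

lemma starPt_mem (θ r φ t : ℝ) :
    starPt φ t ∈ starLine θ r ↔ t * Real.cos (φ - θ) = r := by
  rw [mem_starLine, Real.cos_sub]
  unfold starPt
  simp only
  rw [← sub_eq_zero, ← sub_eq_zero (b := r)]
  ring_nf

lemma starPt_mem_axis (θ φ t : ℝ) :
    starPt φ t ∈ starLine (θ + Real.pi / 2) 0 ↔ t * Real.sin (φ - θ) = 0 := by
  rw [starPt_mem, ← sub_sub, Real.cos_sub_pi_div_two]

lemma zero_mem_starLine (θ r : ℝ) : (0 : ℝ × ℝ) ∈ starLine θ r ↔ r = 0 := by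
  rw [mem_starLine]; simp [eq_comm]

lemma starPt_inj (h i j : ℕ) (hi : i < 2 * h + 1) (hj : j < 2 * h + 1) (t s : ℝ) (ht : t ≠ 0)
    (he : starPt (starAngle h i) t = starPt (starAngle h j) s) : i = j ∧ t = s := by
  have hm : starPt (starAngle h i) t ∈ starLine (starAngle h j + Real.pi / 2) 0 := by
    rw [he, starPt_mem_axis]; simp
  rw [starPt_mem_axis] at hm
  have hij : i = j := star_sin_diff h i j hi hj ((mul_eq_zero.mp hm).resolve_left ht)
  refine ⟨hij, ?_⟩
  subst hij
  have hm : starPt (starAngle h i) t ∈ starLine (starAngle h i) s := by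
    rw [he, starPt_mem]; simp
  rw [starPt_mem] at hm
  simpa using hm

lemma starPt_ne_zero (θ t : ℝ) (ht : t ≠ 0) : starPt θ t ≠ 0 := by
  intro h
  have : starPt θ t ∈ starLine θ 0 := by rw [h, zero_mem_starLine]
  rw [starPt_mem] at this
  simp at this; exact ht this

noncomputable def starSet (h : ℕ) (T : Finset ℝ) : Finset (ℝ × ℝ) :=
  insert 0 ((Finset.range (2 * h + 1) ×ˢ T).image (fun q => starPt (starAngle h q.1) q.2))

lemma mem_starSet (h : ℕ) (T : Finset ℝ) (p : ℝ × ℝ) : p ∈ starSet h T ↔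
    p = 0 ∨ ∃ i t, i < 2 * h + 1 ∧ t ∈ T ∧ starPt (starAngle h i) t = p := by
  simp [starSet, and_assoc]

lemma starSet_card (h : ℕ) (T : Finset ℝ) (hT : ∀ t ∈ T, t ≠ 0) :
    (starSet h T).card = (2 * h + 1) * T.card + 1 := by
  unfold starSet
  rw [Finset.card_insert_of_notMem, Finset.card_image_of_injOn]
  · simp
  · rintro ⟨i, t⟩ hi ⟨j, s⟩ hj he
    simp only [Finset.coe_product, Set.mem_prod, Finset.mem_coe, Finset.mem_range] at hi hj
    obtain ⟨h1, h2⟩ := starPt_inj h i j hi.1 hj.1 t s (hT t hi.2) he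
    rw [h1, h2]
  · intro hm
    simp only [Finset.mem_image, Finset.mem_product, Prod.exists] at hm
    obtain ⟨i, t, h1, h2⟩ := hm
    exact starPt_ne_zero _ _ (hT t h1.2) h2

lemma star_count (h : ℕ) (T : Finset ℝ) (r : ℝ) (hr : r ≠ 0) (hrT : r ∉ T)
    (hc : ∀ e : ℕ, 1 ≤ e → e ≤ h → Real.cos (starAngle h e) ≠ 0 ∧
      r / Real.cos (starAngle h e) ∈ T) (k : ℕ) (hk : k < 2 * h + 1) :
    ((starLine (starAngle h k) r : Set (ℝ × ℝ)) ∩ ↑(starSet h T)).ncard = 2 * h := by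
  have hc' : ∀ i < 2 * h + 1, i ≠ k → Real.cos (starAngle h i - starAngle h k) ≠ 0 ∧
      r / Real.cos (starAngle h i - starAngle h k) ∈ T := by
    intro i hi hik
    obtain ⟨e, h1, h2, h3⟩ := star_cos_diff h i k hi hk hik
    rw [h3]; exact hc e h1 h2
  have heq : ((starLine (starAngle h k) r : Set (ℝ × ℝ)) ∩ ↑(starSet h T)) =
      ↑(((Finset.range (2 * h + 1)).erase k).image (fun i => starPt (starAngle h i)
        (r / Real.cos (starAngle h i - starAngle h k)))) := by
    ext p
    simp only [Set.mem_inter_iff, SetLike.mem_coe, Finset.mem_coe, mem_starSet, Finset.mem_image,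
      Finset.mem_erase, Finset.mem_range]
    constructor
    · rintro ⟨h1, rfl | ⟨i, t, hi, ht, rfl⟩⟩
      · rw [zero_mem_starLine] at h1; exact absurd h1 hr
      · rw [starPt_mem] at h1
        by_cases hik : i = k
        · subst hik
          simp at h1
          rw [h1] at ht; exact absurd ht hrT
        · refine ⟨i, ⟨hik, hi⟩, ?_⟩
          rw [← h1, mul_div_cancel_right₀ _ (hc' i hi hik).1]
    · rintro ⟨i, ⟨hik, hi⟩, rfl⟩
      obtain ⟨h1, h2⟩ := hc' i hi hik
      exact ⟨by rw [starPt_mem, div_mul_cancel₀ _ h1], Or.inr ⟨i, _, hi, h2, rfl⟩⟩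
  rw [heq, Set.ncard_coe_finset, Finset.card_image_of_injOn,
    Finset.card_erase_of_mem (Finset.mem_range.mpr hk)]
  · simp
  · intro i hi j hj he
    simp only [Finset.coe_erase, Finset.coe_range, Set.mem_sdiff, Set.mem_Iio,
      Set.mem_singleton_iff] at hi hj
    exact (starPt_inj h i j hi.1 hj.1 _ _ (div_ne_zero hr (hc' i hi.1 hi.2).1) he).1

lemma star_count_axis (h : ℕ) (T : Finset ℝ) (hT : ∀ t ∈ T, t ≠ 0) (k : ℕ)
    (hk : k < 2 * h + 1) :
    ((starLine (starAngle h k + Real.pi / 2) 0 : Set (ℝ × ℝ)) ∩ ↑(starSet h T)).ncard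
      = T.card + 1 := by
  have heq : ((starLine (starAngle h k + Real.pi / 2) 0 : Set (ℝ × ℝ)) ∩ ↑(starSet h T)) =
      ↑(insert 0 (T.image (fun t => starPt (starAngle h k) t))) := by
    ext p
    simp only [Set.mem_inter_iff, SetLike.mem_coe, Finset.mem_coe, mem_starSet, Finset.mem_image,
      Finset.mem_insert]
    constructor
    · rintro ⟨h1, rfl | ⟨i, t, hi, ht, rfl⟩⟩
      · exact Or.inl rfl
      · rw [starPt_mem_axis] at h1
        have := star_sin_diff h i k hi hk ((mul_eq_zero.mp h1).resolve_left (hT t ht))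
        subst this
        exact Or.inr ⟨t, ht, rfl⟩
    · rintro (rfl | ⟨t, ht, rfl⟩)
      · exact ⟨by rw [zero_mem_starLine], Or.inl rfl⟩
      · exact ⟨by rw [starPt_mem_axis]; simp, Or.inr ⟨k, t, hk, ht, rfl⟩⟩
  rw [heq, Set.ncard_coe_finset, Finset.card_insert_of_notMem, Finset.card_image_of_injOn]
  · intro t ht s hs he
    exact (starPt_inj h k k hk hk _ _ (hT t ht) he).2
  · intro hm
    simp only [Finset.mem_image] at hm
    obtain ⟨t, h1, h2⟩ := hm
    exact starPt_ne_zero _ _ (hT t h1) h2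

lemma starLine_inj (h i j : ℕ) (hi : i < 2 * h + 1) (hj : j < 2 * h + 1) (r : ℝ) (hr : r ≠ 0)
    (he : starLine (starAngle h i) r = starLine (starAngle h j) r) : i = j := by
  have hm : starPt (starAngle h i) r ∈ starLine (starAngle h j) r := by
    rw [← he, starPt_mem]; simp
  rw [starPt_mem] at hm
  have h1 : Real.cos (starAngle h i - starAngle h j) = 1 := mul_left_cancel₀ hr (by linarith)
  apply star_sin_diff h i j hi hj
  have := Real.sin_sq_add_cos_sq (starAngle h i - starAngle h j)
  rw [h1] at this
  exact pow_eq_zero_iff (two_ne_zero) |>.mp (by linarith)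

lemma starLine_axis_inj (h i j : ℕ) (hi : i < 2 * h + 1) (hj : j < 2 * h + 1)
    (he : starLine (starAngle h i + Real.pi / 2) 0 = starLine (starAngle h j + Real.pi / 2) 0) :
    i = j := by
  have hm : starPt (starAngle h i) 1 ∈ starLine (starAngle h j + Real.pi / 2) 0 := by
    rw [← he, starPt_mem_axis]; simp
  rw [starPt_mem_axis, one_mul] at hm
  exact star_sin_diff h i j hi hj hm

lemma starLine_ne (θ φ ρ : ℝ) (hρ : |ρ| < 1) : starLine θ 1 ≠ starLine φ ρ := by
  intro he
  have hm : starPt φ ρ ∈ starLine θ 1 := by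
    rw [he, starPt_mem]; simp
  rw [starPt_mem] at hm
  have h1 : |ρ| * |Real.cos (φ - θ)| = 1 := by rw [← abs_mul, hm]; simp
  nlinarith [Real.abs_cos_le_one (φ - θ), abs_nonneg ρ, abs_nonneg (Real.cos (φ - θ))]

lemma starLine_ne_axis (θ φ r : ℝ) (hr : r ≠ 0) : starLine θ r ≠ starLine φ 0 := by
  intro he
  have hm : (0 : ℝ × ℝ) ∈ starLine θ r := by
    rw [he, zero_mem_starLine]
  rw [zero_mem_starLine] at hm
  exact hr hm

/-- For every even integer `n ≥ 4` there exists a set `S` of `n²` points in ℝ² such that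
there are at least `3n+3` distinct lines each containing exactly `n` points of `S`. -/
theorem double_star_lines (n : ℕ) (hn : 4 ≤ n) (heven : Even n) :
    ∃ S : Finset (ℝ × ℝ), S.card = n ^ 2 ∧
      ∃ L : Finset (AffineSubspace ℝ (ℝ × ℝ)), 3 * n + 3 ≤ L.card ∧
        ∀ l ∈ L, IsLine l ∧ ((l : Set (ℝ × ℝ)) ∩ ↑S).ncard = n := by
  classical
  obtain ⟨h, rfl⟩ := heven
  obtain ⟨ρ, hρ0, hρ1, T, hcard, hT0, h1T, hρT, hc⟩ := star_numeric h (by omega)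
  refine ⟨starSet h T, ?_, ?_⟩
  · rw [starSet_card h T hT0, hcard]
    obtain ⟨g, rfl⟩ : ∃ g, h = g + 1 := ⟨h - 1, by omega⟩
    have : 2 * (g + 1) - 1 = 2 * g + 1 := by omega
    rw [this]; ring
  · set R := Finset.range (2 * h + 1) with hR
    refine ⟨R.image (fun k => starLine (starAngle h k) 1) ∪
      (R.image (fun k => starLine (starAngle h k) ρ) ∪
        R.image (fun k => starLine (starAngle h k + Real.pi / 2) 0)), ?_, ?_⟩
    · rw [Finset.card_union_of_disjoint, Finset.card_union_of_disjoint,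
        Finset.card_image_of_injOn, Finset.card_image_of_injOn, Finset.card_image_of_injOn]
      · simp [hR]; omega
      · intro i hi j hj he
        simp only [hR, Finset.coe_range, Set.mem_Iio] at hi hj
        exact starLine_axis_inj h i j hi hj he
      · intro i hi j hj he
        simp only [hR, Finset.coe_range, Set.mem_Iio] at hi hj
        exact starLine_inj h i j hi hj ρ hρ0 he
      · intro i hi j hj he
        simp only [hR, Finset.coe_range, Set.mem_Iio] at hi hj
        exact starLine_inj h i j hi hj 1 one_ne_zero he
      · rw [Finset.disjoint_left]
        intro l h1 h2
        obtain ⟨i, _, rfl⟩ := Finset.mem_image.mp h1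
        obtain ⟨j, _, h3⟩ := Finset.mem_image.mp h2
        exact starLine_ne_axis _ _ ρ hρ0 h3.symm
      · rw [Finset.disjoint_left]
        intro l h1 h2
        obtain ⟨i, _, rfl⟩ := Finset.mem_image.mp h1
        rcases Finset.mem_union.mp h2 with h2 | h2
        · obtain ⟨j, _, h3⟩ := Finset.mem_image.mp h2
          exact starLine_ne _ _ ρ hρ1 h3.symm
        · obtain ⟨j, _, h3⟩ := Finset.mem_image.mp h2
          exact starLine_ne_axis _ _ 1 one_ne_zero h3.symm
    · intro l hl
      simp only [hR, Finset.mem_union, Finset.mem_image, Finset.mem_range] at hl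
      rcases hl with ⟨k, hk, rfl⟩ | ⟨k, hk, rfl⟩ | ⟨k, hk, rfl⟩
      · refine ⟨starLine_isLine _ _, ?_⟩
        rw [star_count h T 1 one_ne_zero h1T
          (fun e h1 h2 => ⟨(hc e h1 h2).1, (hc e h1 h2).2.1⟩) k hk]
        ring
      · refine ⟨starLine_isLine _ _, ?_⟩
        rw [star_count h T ρ hρ0 hρT
          (fun e h1 h2 => ⟨(hc e h1 h2).1, (hc e h1 h2).2.2⟩) k hk]
        ring
      · refine ⟨starLine_isLine _ _, ?_⟩
        rw [star_count_axis h T hT0 k hk, hcard]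
        omega
end

section
/- There exists a set S of 9 points in ℝ² such that no line contains more than 3 points of S and there are at least 10 distinct lines each containing exactly 3 points of S. (Such a set is obtained from the 3×3 square array by moving an opposite pair of edge midpoints halfway towards the center.) -/
/-- The nine points, with integer coordinates. -/
def ninePts : Finset (ℤ × ℤ) :=
  {(-2, -2), (-2, 0), (-2, 2), (0, -1), (0, 0), (0, 1), (2, -2), (2, 0), (2, 2)}

/-- The ten lines, as pairs (base point, direction). -/
def tenLines : Finset ((ℤ × ℤ) × (ℤ × ℤ)) :=
  {((-2, 0), (0, 1)), ((0, 0), (0, 1)), ((2, 0), (0, 1)), ((0, 0), (1, 0)),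
   ((0, 0), (1, 1)), ((0, 0), (1, -1)), ((0, 1), (2, 1)), ((0, 1), (2, -1)),
   ((0, -1), (2, 1)), ((0, -1), (2, -1))}

/-- The cross product of two integer vectors. -/
def crossZ (u v : ℤ × ℤ) : ℤ := u.1 * v.2 - u.2 * v.1

/-- The inclusion of integer points in the plane. -/
def castPt : (ℤ × ℤ) ↪ (ℝ × ℝ) where
  toFun p := ((p.1 : ℝ), (p.2 : ℝ))
  inj' := by
    rintro ⟨a, b⟩ ⟨c, d⟩ h
    simpa using h

theorem castPt_apply (p : ℤ × ℤ) : castPt p = ((p.1 : ℝ), (p.2 : ℝ)) := rfl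

/-- The real line through `p.1` with direction `p.2`. -/
noncomputable def realLine (p : (ℤ × ℤ) × (ℤ × ℤ)) : AffineSubspace ℝ (ℝ × ℝ) :=
  AffineSubspace.mk' (castPt p.1) (Submodule.span ℝ {castPt p.2})

/-- The points of the configuration on a given line. -/
def ptsOn (p : (ℤ × ℤ) × (ℤ × ℤ)) : Finset (ℤ × ℤ) :=
  ninePts.filter (fun q => crossZ (q - p.1) p.2 = 0)

theorem castPt_ne_zero {v : ℤ × ℤ} (hv : v ≠ 0) : castPt v ≠ 0 := by
  intro h
  apply hv
  apply castPt.injective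
  rw [h]
  simp [castPt_apply]
  rfl

theorem mem_realLine (p : (ℤ × ℤ) × (ℤ × ℤ)) (hp : p.2 ≠ 0) (q : ℤ × ℤ) :
    castPt q ∈ realLine p ↔ crossZ (q - p.1) p.2 = 0 := by
  obtain ⟨⟨a, b⟩, ⟨c, d⟩⟩ := p
  obtain ⟨x, y⟩ := q
  simp only [realLine, AffineSubspace.mem_mk', Submodule.mem_span_singleton, crossZ, castPt_apply,
    vsub_eq_sub, Prod.mk_sub_mk, Prod.smul_mk, Prod.mk.injEq,
    smul_eq_mul]
  rw [← @Int.cast_inj ℝ]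
  push_cast
  constructor
  · rintro ⟨t, h1, h2⟩
    rw [← h1, ← h2]
    ring
  · intro h
    by_cases hc : c = 0
    · have hd : (d : ℝ) ≠ 0 := by
        intro hd
        apply hp
        have : d = 0 := by exact_mod_cast hd
        simp [hc, this]
      refine ⟨(y - b) / d, ?_, by field_simp⟩
      field_simp
      linarith
    · have hc' : (c : ℝ) ≠ 0 := by exact_mod_cast hc
      refine ⟨(x - a) / c, by field_simp, ?_⟩
      field_simp
      linarith

theorem realLine_inter (p : (ℤ × ℤ) × (ℤ × ℤ)) (hp : p.2 ≠ 0) :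
    ((realLine p : Set (ℝ × ℝ)) ∩ ↑(ninePts.map castPt)) = ↑((ptsOn p).map castPt) := by
  ext z
  simp only [Set.mem_inter_iff, SetLike.mem_coe, Finset.mem_map, ptsOn, Finset.mem_filter]
  constructor
  · rintro ⟨h1, q, hq, rfl⟩
    exact ⟨q, ⟨hq, (mem_realLine p hp q).1 h1⟩, rfl⟩
  · rintro ⟨q, ⟨hq, h⟩, rfl⟩
    exact ⟨(mem_realLine p hp q).2 h, q, hq, rfl⟩

theorem isLine_realLine (p : (ℤ × ℤ) × (ℤ × ℤ)) (hp : p.2 ≠ 0) : IsLine (realLine p) := by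
  rw [IsLine, realLine, AffineSubspace.direction_mk']
  exact finrank_span_singleton (castPt_ne_zero hp)

theorem cross_eq_zero_of_isLine {l : AffineSubspace ℝ (ℝ × ℝ)} (hl : IsLine l)
    {p q r : ℤ × ℤ} (hp : castPt p ∈ l) (hq : castPt q ∈ l) (hr : castPt r ∈ l) :
    crossZ (q - p) (r - p) = 0 := by
  obtain ⟨v, -, hv⟩ := finrank_eq_one_iff'.1 hl
  obtain ⟨s, hs⟩ := hv ⟨_, AffineSubspace.vsub_mem_direction hq hp⟩
  obtain ⟨t, ht⟩ := hv ⟨_, AffineSubspace.vsub_mem_direction hr hp⟩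
  have hs' := congrArg Subtype.val hs
  have ht' := congrArg Subtype.val ht
  have s1 := congrArg Prod.fst hs'
  have s2 := congrArg Prod.snd hs'
  have t1 := congrArg Prod.fst ht'
  have t2 := congrArg Prod.snd ht'
  simp [castPt_apply] at s1 s2 t1 t2
  rw [← @Int.cast_inj ℝ]
  simp only [crossZ, Prod.fst_sub, Prod.snd_sub]
  push_cast
  rw [← s1, ← s2, ← t1, ← t2]
  ring

theorem ninePts_two (p : ℤ × ℤ) (hp : p ∈ ninePts) (q : ℤ × ℤ) (hq : q ∈ ninePts) (h : p ≠ q) :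
    (ninePts.filter (fun r => crossZ (q - p) (r - p) = 0)).card ≤ 3 := by
  revert p q
  decide +kernel

theorem nine_upper (l : AffineSubspace ℝ (ℝ × ℝ)) (hl : IsLine l) :
    ((l : Set (ℝ × ℝ)) ∩ ↑(ninePts.map castPt)).ncard ≤ 3 := by
  classical
  set T := ninePts.filter (fun r => castPt r ∈ l) with hT
  have h : ((l : Set (ℝ × ℝ)) ∩ ↑(ninePts.map castPt)) = ↑(T.map castPt) := by
    ext z
    simp only [Set.mem_inter_iff, SetLike.mem_coe, Finset.mem_map, hT, Finset.mem_filter]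
    constructor
    · rintro ⟨h1, q, hq, rfl⟩
      exact ⟨q, ⟨hq, h1⟩, rfl⟩
    · rintro ⟨q, ⟨hq, h⟩, rfl⟩
      exact ⟨h, q, hq, rfl⟩
  rw [h, Set.ncard_coe_finset, Finset.card_map]
  by_contra! hlt
  obtain ⟨p, hp, q, hq, hpq⟩ := Finset.one_lt_card.1 (show 1 < T.card by omega)
  rw [hT, Finset.mem_filter] at hp hq
  have h3 := ninePts_two p hp.1 q hq.1 hpq
  have hsub : T ⊆ ninePts.filter (fun r => crossZ (q - p) (r - p) = 0) := by
    intro r hr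
    rw [hT, Finset.mem_filter] at hr
    rw [Finset.mem_filter]
    exact ⟨hr.1, cross_eq_zero_of_isLine hl hp.2 hq.2 hr.2⟩
  have := Finset.card_le_card hsub
  omega

theorem tenLines_dir : ∀ p ∈ tenLines, p.2 ≠ 0 := by decide +kernel

theorem tenLines_three : ∀ p ∈ tenLines, (ptsOn p).card = 3 := by decide +kernel

theorem tenLines_inj : ∀ p ∈ tenLines, ∀ q ∈ tenLines, ptsOn p = ptsOn q → p = q := by
  decide +kernel

/-- There exists a set `S` of 9 points in ℝ² such that no line contains more than 3 points
of `S` and there are at least 10 distinct lines each containing exactly 3 points of `S`. -/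
theorem nine_points_ten_lines_of_three :
    ∃ S : Finset (ℝ × ℝ), S.card = 9 ∧
      (∀ l : AffineSubspace ℝ (ℝ × ℝ), IsLine l → ((l : Set (ℝ × ℝ)) ∩ ↑S).ncard ≤ 3) ∧
      ∃ L : Finset (AffineSubspace ℝ (ℝ × ℝ)), 10 ≤ L.card ∧
        ∀ l ∈ L, IsLine l ∧ ((l : Set (ℝ × ℝ)) ∩ ↑S).ncard = 3 := by
  classical
  refine ⟨ninePts.map castPt, ?_, nine_upper, tenLines.image realLine, ?_, ?_⟩
  · rw [Finset.card_map]
    decide +kernel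
  · rw [Finset.card_image_of_injOn]
    · decide +kernel
    · intro p hp q hq h
      apply tenLines_inj p hp q hq
      have h1 := realLine_inter p (tenLines_dir p hp)
      have h2 := realLine_inter q (tenLines_dir q hq)
      rw [h, h2] at h1
      exact (Finset.map_injective castPt (Finset.coe_injective h1)).symm
  · intro l hl
    obtain ⟨p, hp, rfl⟩ := Finset.mem_image.1 hl
    refine ⟨isLine_realLine p (tenLines_dir p hp), ?_⟩
    rw [realLine_inter p (tenLines_dir p hp), Set.ncard_coe_finset, Finset.card_map]
    exact tenLines_three p hp
end

section
/- There exists a set S of 25 points in ℝ² such that there are at least 18 distinct lines each containing exactly 5 points of S. -/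
/-- The 25 points, in integer coordinates. -/
def cfgPts : Finset (ℤ × ℤ) :=
  {(-20, -10), (-10, 0), (-10, -20), (0, -20), (0, -10),
   (-20, 0), (-30, -10), (-10, 10), (-10, -30), (10, -30),
   (10, -10), (-30, 10), (-6, -18), (-18, -6), (-6, -6),
   (-30, 0), (0, 0), (0, -30), (-10, -10), (-30, 30),
   (30, -30), (-30, -30), (-15, 0), (0, -15), (-15, -15)}

/-- The 18 lines, as (base point, direction vector). -/
def cfgLines : Finset ((ℤ × ℤ) × (ℤ × ℤ)) :=
  {((-20, -10), (1, -1)), ((-20, -10), (1, 0)), ((-20, -10), (1, 2)), ((-10, 0), (0, -1)), ((-10, 0), (-1, 0)),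
   ((-10, 0), (2, -3)), ((-10, -20), (2, 1)), ((0, -20), (0, 1)), ((0, -20), (-1, 1)), ((0, -20), (-3, 1)),
   ((0, -10), (-3, 2)), ((-20, 0), (1, -3)), ((-30, -10), (0, 1)), ((-10, 10), (1, -1)), ((-10, -30), (1, 0)),
   ((-6, -18), (1, -2)), ((-18, -6), (-2, 1)), ((-6, -6), (1, 1))}

/-- Integer incidence test. -/
def cfgInc (l : (ℤ × ℤ) × (ℤ × ℤ)) (q : ℤ × ℤ) : Prop :=
  (q.1 - l.1.1) * l.2.2 = (q.2 - l.1.2) * l.2.1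

instance (l : (ℤ × ℤ) × (ℤ × ℤ)) (q : ℤ × ℤ) : Decidable (cfgInc l q) := by
  unfold cfgInc; infer_instance

/-- Embedding of integer points in the real plane. -/
def cfgCast (q : ℤ × ℤ) : ℝ × ℝ := ((q.1 : ℝ), (q.2 : ℝ))

theorem cfgCast_inj : Function.Injective cfgCast := by
  rintro ⟨a, b⟩ ⟨c, d⟩ h
  simpa [cfgCast] using h

/-- The real line attached to an integer line description. -/
noncomputable def cfgLine (l : (ℤ × ℤ) × (ℤ × ℤ)) : AffineSubspace ℝ (ℝ × ℝ) :=
  AffineSubspace.mk' (cfgCast l.1) (Submodule.span ℝ {cfgCast l.2})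

theorem cfg_mem (l : (ℤ × ℤ) × (ℤ × ℤ)) (hl : l.2 ≠ 0) (q : ℤ × ℤ) :
    cfgCast q ∈ cfgLine l ↔ cfgInc l q := by
  obtain ⟨⟨a, b⟩, ⟨u, v⟩⟩ := l
  obtain ⟨x, y⟩ := q
  have key : cfgInc ((a, b), (u, v)) (x, y) ↔ ((x : ℝ) - a) * v = ((y : ℝ) - b) * u := by
    unfold cfgInc; norm_cast
  rw [key, cfgLine, AffineSubspace.mem_mk', Submodule.mem_span_singleton]
  simp only [cfgCast, vsub_eq_sub, Prod.smul_mk, Prod.mk_sub_mk, Prod.mk.injEq, smul_eq_mul]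
  constructor
  · rintro ⟨t, h1, h2⟩
    rw [← h1, ← h2]; ring
  · intro h
    by_cases hu : u = 0
    · have hv : (v : ℝ) ≠ 0 := by
        intro hv
        apply hl
        have : v = 0 := by exact_mod_cast hv
        simp [hu, this]
      subst hu
      refine ⟨(y - b) / v, ?_, by field_simp⟩
      simp only [Int.cast_zero, mul_zero] at h ⊢
      exact ((mul_eq_zero.mp h).resolve_right hv).symm
    · have hu' : (u : ℝ) ≠ 0 := by exact_mod_cast hu
      refine ⟨(x - a) / u, by field_simp, ?_⟩
      field_simp
      linarith

theorem cfg_isLine (l : (ℤ × ℤ) × (ℤ × ℤ)) (hl : l.2 ≠ 0) : IsLine (cfgLine l) := by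
  unfold IsLine cfgLine
  rw [AffineSubspace.direction_mk']
  apply finrank_span_singleton
  intro h
  exact hl (cfgCast_inj (by rw [h]; simp [cfgCast]; rfl))

theorem cfg_dir : ∀ l ∈ cfgLines, l.2 ≠ 0 := by decide

set_option maxRecDepth 100000 in
set_option maxHeartbeats 4000000 in
theorem cfg_five : ∀ l ∈ cfgLines, (cfgPts.filter (cfgInc l)).card = 5 := by decide +kernel

set_option maxRecDepth 100000 in
set_option maxHeartbeats 4000000 in
theorem cfg_distinct : ∀ l ∈ cfgLines, ∀ m ∈ cfgLines,
    (∀ q ∈ cfgPts, cfgInc l q ↔ cfgInc m q) → l = m := by decide +kernel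

/-- There exists a set `S` of 25 points in ℝ² such that there are at least 18 distinct
lines each containing exactly 5 points of `S`. -/
theorem twentyfive_points_eighteen_lines_of_five :
    ∃ S : Finset (ℝ × ℝ), S.card = 25 ∧
      ∃ L : Finset (AffineSubspace ℝ (ℝ × ℝ)), 18 ≤ L.card ∧
        ∀ l ∈ L, IsLine l ∧ ((l : Set (ℝ × ℝ)) ∩ ↑S).ncard = 5 := by
  classical
  refine ⟨cfgPts.image cfgCast, ?_, cfgLines.image cfgLine, ?_, ?_⟩
  · rw [Finset.card_image_of_injective _ cfgCast_inj]
    decide +kernel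
  · rw [Finset.card_image_of_injOn]
    · decide +kernel
    · intro l hl m hm h
      refine cfg_distinct l hl m hm fun q _ => ?_
      rw [← cfg_mem l (cfg_dir l hl), ← cfg_mem m (cfg_dir m hm)]
      rw [h]
  · intro l' hl'
    obtain ⟨l, hl, rfl⟩ := Finset.mem_image.mp hl'
    refine ⟨cfg_isLine l (cfg_dir l hl), ?_⟩
    have : ((cfgLine l : Set (ℝ × ℝ)) ∩ ↑(cfgPts.image cfgCast)) =
        ↑((cfgPts.filter (cfgInc l)).image cfgCast) := by
      ext p
      simp only [Set.mem_inter_iff, SetLike.mem_coe, Finset.mem_image,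
        Finset.mem_filter]
      constructor
      · rintro ⟨h, q, hq, rfl⟩
        exact ⟨q, ⟨hq, (cfg_mem l (cfg_dir l hl) q).mp h⟩, rfl⟩
      · rintro ⟨q, ⟨hq, h⟩, rfl⟩
        exact ⟨(cfg_mem l (cfg_dir l hl) q).mpr h, q, hq, rfl⟩
    rw [this, Set.ncard_coe_finset, Finset.card_image_of_injective _ cfgCast_inj]
    exact cfg_five l hl
end

section
/- For every odd integer N ≥ 3 there exists a set S of N² points in ℝ² such that no line contains more than N points of S, and there are at least 3N+1 distinct lines each containing exactly N points of S. (The construction takes the N lines through the origin at angles (i/N)π together with the 2N lines parallel to these at unit distance from the origin, and the N² intersection points of the first family with the second; one additional line of N points arises, after a projective transformation, from the line at infinity.) -/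
namespace OddN

open Real

/-- Non-vertical line `y = c + m x`. -/
noncomputable def gl (c m : ℝ) : AffineSubspace ℝ (ℝ × ℝ) :=
  AffineSubspace.mk' (0, c) (Submodule.span ℝ {((1 : ℝ), m)})

/-- Vertical line `x = t`. -/
noncomputable def vl (t : ℝ) : AffineSubspace ℝ (ℝ × ℝ) :=
  AffineSubspace.mk' (t, 0) (Submodule.span ℝ {((0 : ℝ), (1 : ℝ))})

lemma mem_gl (c m : ℝ) (p : ℝ × ℝ) : p ∈ gl c m ↔ p.2 = c + m * p.1 := by
  unfold gl
  rw [AffineSubspace.mem_mk', Submodule.mem_span_singleton]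
  constructor
  · rintro ⟨a, ha⟩
    have h1 := congrArg Prod.fst ha
    have h2 := congrArg Prod.snd ha
    simp at h1 h2
    subst h1
    linarith
  · intro h
    refine ⟨p.1, ?_⟩
    ext
    · simp
    · simp [h]; ring

lemma mem_vl (t : ℝ) (p : ℝ × ℝ) : p ∈ vl t ↔ p.1 = t := by
  unfold vl
  rw [AffineSubspace.mem_mk', Submodule.mem_span_singleton]
  constructor
  · rintro ⟨a, ha⟩
    have h1 := congrArg Prod.fst ha
    simp at h1
    linarith
  · intro h
    refine ⟨p.2, ?_⟩
    ext
    · simp [h]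
    · simp

lemma isLine_gl (c m : ℝ) : IsLine (gl c m) := by
  unfold IsLine gl
  rw [AffineSubspace.direction_mk']
  exact finrank_span_singleton (by simp)

lemma isLine_vl (t : ℝ) : IsLine (vl t) := by
  unfold IsLine vl
  rw [AffineSubspace.direction_mk']
  exact finrank_span_singleton (by simp)

lemma line_cases (l : AffineSubspace ℝ (ℝ × ℝ)) (hl : IsLine l) :
    (∀ p ∈ l, ∀ q ∈ l, p.1 = q.1 → p = q) ∨ (∀ p ∈ l, ∀ q ∈ l, p.1 = q.1) := by
  obtain ⟨v, hv, hspan⟩ := finrank_eq_one_iff'.1 hl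
  have key : ∀ p ∈ l, ∀ q ∈ l, ∃ c : ℝ, p - q = c • (v : ℝ × ℝ) := by
    intro p hp q hq
    have hd : p -ᵥ q ∈ l.direction := AffineSubspace.vsub_mem_direction hp hq
    obtain ⟨c, hc⟩ := hspan ⟨_, hd⟩
    refine ⟨c, ?_⟩
    have := congrArg Subtype.val hc
    simpa using this.symm
  by_cases h0 : (v : ℝ × ℝ).1 = 0
  · right
    intro p hp q hq
    obtain ⟨c, hc⟩ := key p hp q hq
    have h1 := congrArg Prod.fst hc
    simp [h0] at h1
    linarith
  · left
    intro p hp q hq hpq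
    obtain ⟨c, hc⟩ := key p hp q hq
    have h1 := congrArg Prod.fst hc
    simp [hpq, h0] at h1
    rw [h1, zero_smul] at hc
    exact sub_eq_zero.1 hc

lemma cos_ne (N : ℕ) (hN : 3 ≤ N) (hodd : Odd N) (i : ℕ) : cos (i * π / N) ≠ 0 := by
  intro h
  obtain ⟨k, hk⟩ := Real.cos_eq_zero_iff.1 h
  have hN0 : (N : ℝ) ≠ 0 := by positivity
  have hpi := Real.pi_ne_zero
  field_simp at hk
  have h2 : (i : ℤ) * 2 = N * (2 * k + 1) := by
    exact_mod_cast hk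
  have ho : Odd ((N : ℤ) * (2 * k + 1)) :=
    (by exact_mod_cast hodd : Odd (N : ℤ)).mul ⟨k, rfl⟩
  rw [← h2] at ho
  exact (Int.not_odd_iff_even.2 ⟨i, by ring⟩) ho

lemma tan_inj (N : ℕ) (hN : 3 ≤ N) (hodd : Odd N) (i j : ℕ) (hi : i < N) (hj : j < N)
    (h : tan (i * π / N) = tan (j * π / N)) : i = j := by
  have hN0 : (N : ℝ) ≠ 0 := by positivity
  have hpi := Real.pi_ne_zero
  rw [tan_eq_sin_div_cos, tan_eq_sin_div_cos,
    div_eq_div_iff (cos_ne N hN hodd i) (cos_ne N hN hodd j)] at h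
  have h0 : sin (i * π / N - j * π / N) = 0 := by
    rw [sin_sub]; linarith
  obtain ⟨n, hn⟩ := Real.sin_eq_zero_iff.1 h0
  field_simp at hn
  have h2 : (n : ℤ) * N = i - j := by
    have : (n : ℝ) * N = i - j := by linarith
    exact_mod_cast this
  have h3 : n = 0 := by
    have : n < 1 := by nlinarith
    have : -1 < n := by nlinarith
    omega
  subst h3
  omega

lemma sin_inj (N : ℕ) (hN : 3 ≤ N) (hodd : Odd N) (i j : ℕ) (hi : i < N) (hj : j < N)
    (h : sin (2 * i * π / N) = sin (2 * j * π / N)) : i = j := by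
  have hN0 : (N : ℝ) ≠ 0 := by positivity
  have hpi := Real.pi_ne_zero
  obtain ⟨n, hn | hn⟩ := Real.sin_eq_sin_iff.1 h
  · field_simp at hn
    have h2 : (j : ℤ) = N * n + i := by
      have : (j : ℝ) = N * n + i := by linarith
      exact_mod_cast this
    have h3 : n = 0 := by
      have : n < 1 := by nlinarith
      have : -1 < n := by nlinarith
      omega
    subst h3
    omega
  · field_simp at hn
    have h2 : 2 * (j : ℤ) + 2 * i = N * (2 * n + 1) := by
      have : 2 * (j : ℝ) + 2 * i = N * (2 * n + 1) := by linarith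
      exact_mod_cast this
    have ho : Odd ((N : ℤ) * (2 * n + 1)) :=
      (by exact_mod_cast hodd : Odd (N : ℤ)).mul ⟨n, rfl⟩
    rw [← h2] at ho
    exact absurd ho (Int.not_odd_iff_even.2 ⟨j + i, by ring⟩)

lemma sin_even (N : ℕ) (hN : 3 ≤ N) (a : ℤ) :
    ∃ k < N, sin (2 * a * π / N) = sin (2 * (k : ℕ) * π / N) := by
  have hN0 : (N : ℝ) ≠ 0 := by positivity
  have hNz : (0 : ℤ) < N := by omega
  have h1 := Int.emod_nonneg a hNz.ne'
  have h2 := Int.emod_lt_of_pos a hNz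
  have h3 := Int.emod_add_mul_ediv a N
  refine ⟨(a % N).toNat, by omega, ?_⟩
  have h4 : (((a % N).toNat : ℕ) : ℝ) = ((a % N : ℤ) : ℝ) := by
    exact_mod_cast Int.toNat_of_nonneg h1
  rw [h4]
  have h5 : (a : ℝ) = ((a % N : ℤ) : ℝ) + N * ((a / N : ℤ) : ℝ) := by exact_mod_cast h3.symm
  rw [← Real.sin_add_int_mul_two_pi (2 * ((a % N : ℤ) : ℝ) * π / N) (a / N)]
  congr 1
  rw [h5]
  generalize ((a % N : ℤ) : ℝ) = r
  generalize ((a / N : ℤ) : ℝ) = q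
  field_simp

lemma sin_all (N : ℕ) (hN : 3 ≤ N) (hodd : Odd N) (m : ℤ) :
    ∃ k < N, sin (m * π / N) = sin (2 * (k : ℕ) * π / N) := by
  have hN0 : (N : ℝ) ≠ 0 := by positivity
  rcases Int.even_or_odd' m with ⟨a, ha | ha⟩
  · obtain ⟨k, hk, h⟩ := sin_even N hN a
    refine ⟨k, hk, ?_⟩
    rw [← h, ha]; push_cast; rfl
  · obtain ⟨b, hb⟩ := hodd
    obtain ⟨k, hk, h⟩ := sin_even N hN (b - a)
    refine ⟨k, hk, ?_⟩
    rw [← h, ← Real.sin_pi_sub, ha]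
    congr 1
    have : (N : ℝ) = 2 * b + 1 := by exact_mod_cast hb
    field_simp
    push_cast
    rw [this]; ring

lemma ang_inj (N : ℕ) (hN : 3 ≤ N) (i j : ℕ) (hi : i < 2 * N) (hj : j < 2 * N)
    (hs : sin (i * π / N) = sin (j * π / N)) (hc : cos (i * π / N) = cos (j * π / N)) :
    i = j := by
  have hN0 : (N : ℝ) ≠ 0 := by positivity
  have hpi := Real.pi_ne_zero
  have h0 : cos (i * π / N - j * π / N) = 1 := by
    rw [cos_sub, hs, hc]; nlinarith [sin_sq_add_cos_sq (j * π / N)]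
  obtain ⟨n, hn⟩ := (Real.cos_eq_one_iff _).1 h0
  field_simp at hn
  have h2 : (n : ℤ) * (2 * N) = i - j := by
    have : (n : ℝ) * (2 * N) = i - j := by linarith
    exact_mod_cast this
  have h3 : n = 0 := by
    have : n < 1 := by nlinarith
    have : -1 < n := by nlinarith
    omega
  subst h3
  omega

/-- The points of the configuration. -/
noncomputable def pt (N : ℕ) (q : Fin N × Fin N) : ℝ × ℝ :=
  (tan ((q.1 : ℕ) * π / N), sin (2 * (q.2 : ℕ) * π / N) / cos ((q.1 : ℕ) * π / N))

lemma pt_inj (N : ℕ) (hN : 3 ≤ N) (hodd : Odd N) : Function.Injective (pt N) := by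
  rintro ⟨i, k⟩ ⟨j, k'⟩ h
  have h1 := congrArg Prod.fst h
  have h2 := congrArg Prod.snd h
  simp only [pt] at h1 h2
  have hij : i = j := Fin.ext (tan_inj N hN hodd i j i.2 j.2 h1)
  subst hij
  have h3 := (div_left_inj' (cos_ne N hN hodd i)).1 h2
  have : k = k' := Fin.ext (sin_inj N hN hodd k k' k.2 k'.2 h3)
  rw [this]

/-- The lines of the configuration. -/
noncomputable def ln (N : ℕ) : Option (Fin N ⊕ Fin (2 * N)) → AffineSubspace ℝ (ℝ × ℝ)
  | none => gl 0 0
  | some (Sum.inl i) => vl (tan ((i : ℕ) * π / N))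
  | some (Sum.inr m) => gl (sin ((m : ℕ) * π / N)) (-cos ((m : ℕ) * π / N))

lemma gl_inj {c m c' m' : ℝ} (h : gl c m = gl c' m') : c = c' ∧ m = m' := by
  have h0 : ((0 : ℝ), c) ∈ gl c' m' := by rw [← h, mem_gl]; simp
  have h1 : ((1 : ℝ), c + m) ∈ gl c' m' := by rw [← h, mem_gl]; simp
  rw [mem_gl] at h0 h1
  simp at h0 h1
  exact ⟨h0, by linarith⟩

lemma vl_inj {t t' : ℝ} (h : vl t = vl t') : t = t' := by
  have h0 : (t, (0 : ℝ)) ∈ vl t' := by rw [← h, mem_vl]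
  rwa [mem_vl] at h0

lemma vl_ne_gl {t c m : ℝ} (h : vl t = gl c m) : False := by
  have h0 : (t, c + m * t + 1) ∈ gl c m := by rw [← h, mem_vl]
  rw [mem_gl] at h0
  simp at h0

lemma gl_ne_zero (x : ℝ) (h : gl 0 0 = gl (sin x) (-cos x)) : False := by
  obtain ⟨h1, h2⟩ := gl_inj h
  have h3 := sin_sq_add_cos_sq x
  have h4 : cos x = 0 := by linarith
  rw [← h1, h4] at h3
  norm_num at h3

lemma ln_inj (N : ℕ) (hN : 3 ≤ N) (hodd : Odd N) : Function.Injective (ln N) := by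
  rintro (_ | i | m) (_ | j | m') h <;> simp only [ln] at h
  · rfl
  · exact (vl_ne_gl h.symm).elim
  · exact (gl_ne_zero _ h).elim
  · exact (vl_ne_gl h).elim
  · rw [Fin.ext (tan_inj N hN hodd i j i.2 j.2 (vl_inj h))]
  · exact (vl_ne_gl h).elim
  · exact (gl_ne_zero _ h.symm).elim
  · exact (vl_ne_gl h.symm).elim
  · obtain ⟨h1, h2⟩ := gl_inj h
    rw [Fin.ext (ang_inj N hN m m' m.2 m'.2 h1 (neg_inj.1 h2))]

/-- The point set. -/
noncomputable def S (N : ℕ) : Finset (ℝ × ℝ) := Finset.univ.image (pt N)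

lemma mem_S (N : ℕ) (p : ℝ × ℝ) : p ∈ S N ↔ ∃ q, pt N q = p := by
  simp [S]

lemma upper (N : ℕ) (hN : 3 ≤ N) (hodd : Odd N) (l : AffineSubspace ℝ (ℝ × ℝ))
    (hl : IsLine l) : ((l : Set (ℝ × ℝ)) ∩ ↑(S N)).ncard ≤ N := by
  classical
  rcases line_cases l hl with h | h
  · have : ((l : Set (ℝ × ℝ)) ∩ ↑(S N)).ncard ≤
        ((Finset.univ.image (fun i : Fin N => tan ((i : ℕ) * π / N)) : Finset ℝ) :
          Set ℝ).ncard := by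
      apply Set.ncard_le_ncard_of_injOn Prod.fst
      · rintro p ⟨-, hp⟩
        obtain ⟨q, rfl⟩ := (mem_S N p).1 hp
        simp [pt]
      · intro p hp q hq hpq
        exact h p hp.1 q hq.1 hpq
    refine this.trans ?_
    rw [Set.ncard_coe_finset]
    exact Finset.card_image_le.trans (by simp)
  · rcases Set.eq_empty_or_nonempty ((l : Set (ℝ × ℝ)) ∩ ↑(S N)) with he | ⟨p, hpl, hp⟩
    · rw [he]; simp
    · obtain ⟨⟨i, k⟩, rfl⟩ := (mem_S N p).1 hp
      have : ((l : Set (ℝ × ℝ)) ∩ ↑(S N)) ⊆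
          ((Finset.univ.image (fun k : Fin N => pt N (i, k)) : Finset (ℝ × ℝ)) :
            Set (ℝ × ℝ)) := by
        rintro p ⟨hl', hp'⟩
        obtain ⟨⟨j, k'⟩, rfl⟩ := (mem_S N p).1 hp'
        have h1 := h _ hpl _ hl'
        have hij : i = j := Fin.ext (tan_inj N hN hodd i j i.2 j.2 h1)
        subst hij
        simp
      refine (Set.ncard_le_ncard this (Finset.finite_toSet _)).trans ?_
      rw [Set.ncard_coe_finset]
      exact Finset.card_image_le.trans (by simp)

lemma lower (N : ℕ) (hN : 3 ≤ N) (hodd : Odd N) (l : AffineSubspace ℝ (ℝ × ℝ))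
    (f : Fin N → Fin N × Fin N) (hf : Function.Injective f) (hl : ∀ i, pt N (f i) ∈ l) :
    N ≤ ((l : Set (ℝ × ℝ)) ∩ ↑(S N)).ncard := by
  classical
  have : ((Finset.univ.image (fun k : Fin N => pt N (f k)) : Finset (ℝ × ℝ)) :
            Set (ℝ × ℝ)) ⊆ ((l : Set (ℝ × ℝ)) ∩ ↑(S N)) := by
    intro p hp
    simp only [Finset.coe_image, Finset.coe_univ, Set.image_univ, Set.mem_range] at hp
    obtain ⟨i, rfl⟩ := hp
    exact ⟨hl i, (mem_S N _).2 ⟨_, rfl⟩⟩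
  have h2 := Set.ncard_le_ncard this ((Finset.finite_toSet _).inter_of_right _)
  have hinj : Function.Injective (fun k : Fin N => pt N (f k)) := (pt_inj N hN hodd).comp hf
  rw [Set.ncard_coe_finset, Finset.card_image_of_injective _ hinj] at h2
  simpa using h2

lemma ln_spec (N : ℕ) (hN : 3 ≤ N) (hodd : Odd N) (x) :
    IsLine (ln N x) ∧ N ≤ ((ln N x : Set (ℝ × ℝ)) ∩ ↑(S N)).ncard := by
  have hN0 : (N : ℝ) ≠ 0 := by positivity
  rcases x with (_ | i | m)
  · refine ⟨isLine_gl _ _, lower N hN hodd _ (fun i => (i, ⟨0, by omega⟩)) ?_ ?_⟩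
    · intro a b h; simpa using h
    · intro i
      simp [ln, mem_gl, pt]
  · refine ⟨isLine_vl _, lower N hN hodd _ (fun k => (i, k)) ?_ ?_⟩
    · intro a b h; simpa using h
    · intro k
      simp [ln, mem_vl, pt]
  · have key : ∀ i : Fin N, ∃ k : Fin N,
        sin (((m : ℕ) : ℝ) * π / N - ((i : ℕ) : ℝ) * π / N) = sin (2 * (k : ℕ) * π / N) := by
      intro i
      obtain ⟨k, hk, h⟩ := sin_all N hN hodd ((m : ℕ) - (i : ℕ) : ℤ)
      refine ⟨⟨k, hk⟩, ?_⟩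
      rw [← h]
      congr 1
      push_cast
      ring
    choose g hg using key
    refine ⟨isLine_gl _ _, lower N hN hodd _ (fun i => (i, g i)) ?_ ?_⟩
    · intro a b h; exact congrArg Prod.fst h
    · intro i
      have hc := cos_ne N hN hodd i
      simp only [ln, mem_gl, pt]
      rw [← hg i, sin_sub, tan_eq_sin_div_cos, eq_comm]
      rw [eq_div_iff hc, add_mul, mul_assoc, div_mul_cancel₀ _ hc]
      ring

end OddN

/-- For every odd integer `N ≥ 3` there exists a set `S` of `N²` points in ℝ² such that
no line contains more than `N` points of `S`, and there are at least `3N+1` distinct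
lines each containing exactly `N` points of `S`. -/
theorem odd_N_threeN_plus_one_lines (N : ℕ) (hN : 3 ≤ N) (hodd : Odd N) :
    ∃ S : Finset (ℝ × ℝ), S.card = N ^ 2 ∧
      (∀ l : AffineSubspace ℝ (ℝ × ℝ), IsLine l → ((l : Set (ℝ × ℝ)) ∩ ↑S).ncard ≤ N) ∧
      ∃ L : Finset (AffineSubspace ℝ (ℝ × ℝ)), 3 * N + 1 ≤ L.card ∧
        ∀ l ∈ L, IsLine l ∧ ((l : Set (ℝ × ℝ)) ∩ ↑S).ncard = N := by
  classical
  refine ⟨OddN.S N, ?_, OddN.upper N hN hodd, Finset.univ.image (OddN.ln N), ?_, ?_⟩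
  · unfold OddN.S
    rw [Finset.card_image_of_injective _ (OddN.pt_inj N hN hodd)]
    simp [sq]
  · rw [Finset.card_image_of_injective _ (OddN.ln_inj N hN hodd)]
    simp
    omega
  · intro l hl
    obtain ⟨x, -, rfl⟩ := Finset.mem_image.1 hl
    obtain ⟨h1, h2⟩ := OddN.ln_spec N hN hodd x
    exact ⟨h1, le_antisymm (OddN.upper N hN hodd _ h1) h2⟩
end

section
/- For every integer m ≥ 1, setting n = 12m − 1, there exists a set S of n² points in ℝ² such that there are at least 2n+2 distinct lines each containing exactly n points of S, and in addition at least n+2 distinct lines each containing exactly n+1 points of S. -/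
def lineOf (a b c : ℝ) : AffineSubspace ℝ (ℝ × ℝ) where
  carrier := {p | a * p.1 + b * p.2 + c = 0}
  smul_vsub_vadd_mem' := by
    intro t p q r hp hq hr
    simp only [Set.mem_ofPred_eq, vsub_eq_sub, vadd_eq_add, Prod.fst_add, Prod.snd_add,
      Prod.smul_fst, Prod.smul_snd, Prod.fst_sub, Prod.snd_sub, smul_eq_mul] at *
    linear_combination t * hp - t * hq + hr

theorem mem_lineOf {a b c : ℝ} {p : ℝ × ℝ} : p ∈ lineOf a b c ↔ a * p.1 + b * p.2 + c = 0 :=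
  Iff.rfl

theorem lineOf_sq_pos {a b : ℝ} (h : ¬ (a = 0 ∧ b = 0)) : 0 < a ^ 2 + b ^ 2 := by
  by_contra hc
  exact h ⟨by nlinarith [sq_nonneg a, sq_nonneg b], by nlinarith [sq_nonneg a, sq_nonneg b]⟩

theorem isLine_lineOf {a b c : ℝ} (h : ¬ (a = 0 ∧ b = 0)) : IsLine (lineOf a b c) := by
  have hpos := lineOf_sq_pos h
  have hp0 : ((-a * c / (a ^ 2 + b ^ 2), -b * c / (a ^ 2 + b ^ 2)) : ℝ × ℝ) ∈ lineOf a b c := by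
    rw [mem_lineOf]
    field_simp
    ring
  have hd : (lineOf a b c).direction = Submodule.span ℝ {((-b, a) : ℝ × ℝ)} := by
    ext v
    rw [AffineSubspace.mem_direction_iff_eq_vsub_right hp0, Submodule.mem_span_singleton]
    constructor
    · rintro ⟨q, hq, rfl⟩
      have h1 := mem_lineOf.1 hq
      have h2 := mem_lineOf.1 hp0
      generalize ((-a * c / (a ^ 2 + b ^ 2), -b * c / (a ^ 2 + b ^ 2)) : ℝ × ℝ) = p at h2 ⊢
      refine ⟨(a * (q.2 - p.2) - b * (q.1 - p.1)) / (a ^ 2 + b ^ 2), ?_⟩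
      have h3 : a * (q.1 - p.1) + b * (q.2 - p.2) = 0 := by linarith
      ext
      · simp only [Prod.smul_fst, smul_eq_mul, vsub_eq_sub, Prod.fst_sub]
        field_simp
        linear_combination (-a) * h3
      · simp only [Prod.smul_snd, smul_eq_mul, vsub_eq_sub, Prod.snd_sub]
        field_simp
        linear_combination (-b) * h3
    · rintro ⟨t, rfl⟩
      refine ⟨t • ((-b, a) : ℝ × ℝ) + (-a * c / (a ^ 2 + b ^ 2), -b * c / (a ^ 2 + b ^ 2)), ?_, by simp⟩
      have h2 := mem_lineOf.1 hp0
      rw [mem_lineOf]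
      simp only [Prod.fst_add, Prod.snd_add, Prod.smul_fst, Prod.smul_snd, smul_eq_mul] at h2 ⊢
      linear_combination h2
  unfold IsLine
  rw [hd]
  apply finrank_span_singleton
  intro h0
  rw [Prod.mk_eq_zero] at h0
  exact h ⟨h0.2, by linarith [h0.1]⟩

/-- Equal lines have proportional coefficients. -/
theorem lineOf_cross {a b c a' b' c' : ℝ} (h : ¬ (a = 0 ∧ b = 0))
    (he : lineOf a b c = lineOf a' b' c') :
    a * b' = a' * b ∧ a * c' = a' * c ∧ b * c' = b' * c := by
  have hpos := lineOf_sq_pos h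
  have key : ∀ t : ℝ, a' * (-a * c / (a ^ 2 + b ^ 2) + t * (-b)) +
      b' * (-b * c / (a ^ 2 + b ^ 2) + t * a) + c' = 0 := by
    intro t
    have : ((-a * c / (a ^ 2 + b ^ 2) + t * (-b), -b * c / (a ^ 2 + b ^ 2) + t * a) : ℝ × ℝ)
        ∈ lineOf a b c := by
      rw [mem_lineOf]
      field_simp
      ring
    rw [he] at this
    exact mem_lineOf.1 this
  have h0 := key 0
  have h1 := key 1
  have hx : a * b' = a' * b := by linear_combination h1 - h0
  have h2 : c' * (a ^ 2 + b ^ 2) = (a' * a + b' * b) * c := by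
    field_simp at h0
    linear_combination h0
  refine ⟨hx, ?_, ?_⟩
  · apply mul_right_cancel₀ hpos.ne'
    linear_combination a * h2 + b * c * hx
  · apply mul_right_cancel₀ hpos.ne'
    linear_combination b * h2 - a * c * hx

open Real in
/-- The angular unit `π / N` with `N = 12 m`. -/
noncomputable def eps (m : ℕ) : ℝ := π / (12 * m)

/-- The radius of the circle touched by the side number `c`. -/
noncomputable def rho (m c : ℕ) : ℝ := if Even c then 1 else 2 * Real.cos (eps m)

/-- Inverse radius of the intersection of side `c` with axis `k`. -/
noncomputable def vv (m k c : ℕ) : ℝ := Real.cos (((c : ℝ) - k) * eps m) / rho m c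

/-- The same, indexed by the difference. -/
noncomputable def ff (m k d : ℕ) : ℝ := Real.cos ((d : ℝ) * eps m) / rho m (k + d)

theorem eps_pos {m : ℕ} (hm : 1 ≤ m) : 0 < eps m := by
  unfold eps
  have : (1 : ℝ) ≤ m := by exact_mod_cast hm
  have := Real.pi_pos
  positivity

theorem m_eps {m : ℕ} (hm : 1 ≤ m) : (m : ℝ) * eps m = Real.pi / 12 := by
  unfold eps
  have : (1 : ℝ) ≤ m := by exact_mod_cast hm
  field_simp

theorem eps_le {m : ℕ} (hm : 1 ≤ m) : eps m ≤ Real.pi / 12 := by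
  have h1 : (1 : ℝ) ≤ m := by exact_mod_cast hm
  rw [← m_eps hm]
  nlinarith [eps_pos hm]

theorem cos_eps_gt {m : ℕ} (hm : 1 ≤ m) : 1 / 2 < Real.cos (eps m) := by
  rw [← Real.cos_pi_div_three]
  have := eps_le hm
  have := eps_pos hm
  have := Real.pi_pos
  apply Real.cos_lt_cos_of_nonneg_of_le_pi <;> linarith

theorem cos_eps_lt {m : ℕ} (hm : 1 ≤ m) : Real.cos (eps m) < 1 := by
  rw [← Real.cos_zero]
  have := eps_le hm
  have := eps_pos hm
  have := Real.pi_pos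
  apply Real.cos_lt_cos_of_nonneg_of_le_pi <;> linarith

theorem rho_ge {m : ℕ} (hm : 1 ≤ m) (c : ℕ) : 1 ≤ rho m c := by
  unfold rho
  split_ifs
  · exact le_rfl
  · linarith [cos_eps_gt hm]

theorem rho_congr {m c d : ℕ} (h : c % 2 = d % 2) : rho m c = rho m d := by
  unfold rho
  simp only [Nat.even_iff, h]

/-- No touching point of the outer circle is a crossing of the inner circle. -/
theorem cos_ne {m : ℕ} (hm : 1 ≤ m) {d : ℕ} (hd : d ≤ 12 * m) :
    2 * Real.cos (eps m) * Real.cos (d * eps m) ≠ -1 := by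
  have h0 := eps_pos hm
  have h1 := eps_le hm
  have h2 := m_eps hm
  have hpi := Real.pi_pos
  have hg := cos_eps_gt hm
  have hl := cos_eps_lt hm
  have hdN : (d : ℝ) * eps m ≤ Real.pi := by
    have : (d : ℝ) ≤ 12 * m := by exact_mod_cast hd
    nlinarith
  have h23 : Real.cos (2 * Real.pi / 3) = -1 / 2 := by
    rw [show 2 * Real.pi / 3 = Real.pi - Real.pi / 3 by ring, Real.cos_pi_sub,
      Real.cos_pi_div_three]
    ring
  rcases Nat.lt_or_ge (8 * m) d with h | h
  · have h' : (8 * m + 1 : ℝ) ≤ d := by exact_mod_cast h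
    have h3 : 2 * Real.pi / 3 + eps m ≤ d * eps m := by nlinarith
    have h4 : Real.cos (d * eps m) ≤ Real.cos (2 * Real.pi / 3 + eps m) :=
      Real.cos_le_cos_of_nonneg_of_le_pi (by linarith) hdN h3
    have h5 : 2 * Real.cos (eps m) * Real.cos (2 * Real.pi / 3 + eps m) =
        Real.cos (2 * Real.pi / 3) + Real.cos (2 * Real.pi / 3 + 2 * eps m) := by
      have g : ∀ z y : ℝ, 2 * Real.cos y * Real.cos z = Real.cos (z - y) + Real.cos (z + y) := by
        intro z y
        rw [Real.cos_sub, Real.cos_add]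
        ring
      rw [g]
      congr 2 <;> ring
    have h6 : Real.cos (2 * Real.pi / 3 + 2 * eps m) < Real.cos (2 * Real.pi / 3) :=
      Real.cos_lt_cos_of_nonneg_of_le_pi (by linarith) (by linarith) (by linarith)
    nlinarith
  · have h' : (d : ℝ) ≤ 8 * m := by exact_mod_cast h
    have h3 : d * eps m ≤ 2 * Real.pi / 3 := by nlinarith
    have h4 : Real.cos (2 * Real.pi / 3) ≤ Real.cos (d * eps m) :=
      Real.cos_le_cos_of_nonneg_of_le_pi (by positivity) (by linarith) h3
    nlinarith

theorem neg_one_lt_cos {m : ℕ} (hm : 1 ≤ m) {d : ℕ} (hd : d < 12 * m) :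
    -1 < Real.cos (d * eps m) := by
  rw [← Real.cos_pi]
  have h0 := eps_pos hm
  have h2 := m_eps hm
  have : (d : ℝ) < 12 * m := by exact_mod_cast hd
  exact Real.cos_lt_cos_of_nonneg_of_le_pi (by positivity) le_rfl (by nlinarith)

theorem vv_eq_ff {m : ℕ} (hm : 1 ≤ m) {k c : ℕ} (hk : k < 12 * m) (hc : c < 24 * m)
    (hne : c ≠ k + 12 * m) : ∃ d < 12 * m, vv m k c = ff m k d := by
  have h2 := m_eps hm
  rcases Nat.lt_or_ge c k with h | h
  · refine ⟨k - c, by omega, ?_⟩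
    unfold vv ff
    rw [rho_congr (show c % 2 = (k + (k - c)) % 2 by omega), Nat.cast_sub h.le,
      ← Real.cos_neg]
    congr 2
    ring
  · rcases Nat.lt_or_ge c (k + 12 * m) with h' | h'
    · refine ⟨c - k, by omega, ?_⟩
      unfold vv ff
      rw [rho_congr (show c % 2 = (k + (c - k)) % 2 by omega), Nat.cast_sub h]
    · refine ⟨24 * m - (c - k), by omega, ?_⟩
      unfold vv ff
      rw [rho_congr (show c % 2 = (k + (24 * m - (c - k))) % 2 by omega),
        Nat.cast_sub (show c - k ≤ 24 * m by omega), Nat.cast_sub h,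
        ← Real.cos_two_pi_sub]
      congr 2
      push_cast
      linear_combination (-24) * h2

theorem vv_ne {m : ℕ} (hm : 1 ≤ m) {k c : ℕ} (hk : k < 12 * m) (hc : c < 24 * m)
    (hne : c ≠ k + 12 * m) : vv m k c ≠ vv m k (k + 12 * m) := by
  obtain ⟨d, hd, he⟩ := vv_eq_ff hm hk hc hne
  rw [he]
  have h2 := m_eps hm
  have hv : vv m k (k + 12 * m) = -1 / rho m k := by
    unfold vv
    rw [rho_congr (show (k + 12 * m) % 2 = k % 2 by omega)]
    congr 1
    rw [← Real.cos_pi]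
    congr 1
    push_cast
    linear_combination 12 * h2
  rw [hv]
  unfold ff
  intro h
  have r1 := rho_ge hm k
  have r2 := rho_ge hm (k + d)
  rw [div_eq_div_iff (by linarith) (by linarith)] at h
  have h3 := neg_one_lt_cos hm hd
  have h4 := cos_ne hm hd.le
  rcases Nat.even_or_odd d with hde | hdo
  · rw [rho_congr (show (k + d) % 2 = k % 2 by have := Nat.even_iff.1 hde; omega)] at h
    nlinarith
  · rcases Nat.even_or_odd k with hke | hko
    · have : rho m k = 1 := by unfold rho; rw [if_pos hke]
      rw [this] at h
      nlinarith
    · have e1 : rho m k = 2 * Real.cos (eps m) := by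
        unfold rho; rw [if_neg (Nat.not_even_iff_odd.2 hko)]
      have e2 : rho m (k + d) = 1 := by unfold rho; rw [if_pos (hko.add_odd hdo)]
      rw [e1, e2] at h
      apply h4
      linarith

theorem vv_le {m : ℕ} (hm : 1 ≤ m) (k c : ℕ) : vv m k c ≤ 1 := by
  unfold vv
  have := rho_ge hm c
  rw [div_le_one (by linarith)]
  exact (Real.cos_le_one _).trans this

theorem vv_zero {m : ℕ} (hm : 1 ≤ m) (k : ℕ) : vv m k (k + 6 * m) = 0 := by
  unfold vv
  have h2 := m_eps hm
  have : (((k + 6 * m : ℕ) : ℝ) - k) * eps m = Real.pi / 2 := by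
    push_cast
    linear_combination 6 * h2
  rw [this, Real.cos_pi_div_two, zero_div]

/-- The inverse radii of the points on axis `k`. -/
noncomputable def WW (m k : ℕ) : Finset ℝ :=
  ((Finset.range (24 * m)).erase (k + 12 * m)).image (vv m k)

theorem ff_even {m : ℕ} (hm : 1 ≤ m) {k : ℕ} (hk : Even k) :
    ff m k 1 = ff m k (4 * m) ∧ ff m k (12 * m - 1) = ff m k (8 * m) := by
  have h2 := m_eps hm
  have hg := cos_eps_gt hm
  have hk2 := Nat.even_iff.1 hk
  have o : ∀ c, c % 2 = 1 → rho m c = 2 * Real.cos (eps m) := fun c hc => by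
    unfold rho; rw [if_neg (by rw [Nat.even_iff]; omega)]
  have e : ∀ c, c % 2 = 0 → rho m c = 1 := fun c hc => by
    unfold rho; rw [if_pos (Nat.even_iff.2 hc)]
  unfold ff
  rw [o (k + 1) (by omega), o (k + (12 * m - 1)) (by omega), e (k + 4 * m) (by omega),
    e (k + 8 * m) (by omega)]
  have a1 : ((4 * m : ℕ) : ℝ) * eps m = Real.pi / 3 := by
    push_cast; linear_combination 4 * h2
  have a2 : ((8 * m : ℕ) : ℝ) * eps m = Real.pi - Real.pi / 3 := by
    push_cast; linear_combination 8 * h2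
  have a3 : ((12 * m - 1 : ℕ) : ℝ) * eps m = Real.pi - eps m := by
    rw [Nat.cast_sub (by omega)]
    push_cast; linear_combination 12 * h2
  rw [a1, a2, a3, Real.cos_pi_sub, Real.cos_pi_sub, Real.cos_pi_div_three, Nat.cast_one, one_mul]
  constructor <;> field_simp

theorem ff_odd {m : ℕ} (hm : 1 ≤ m) {k : ℕ} (hk : ¬ Even k) :
    ff m k (6 * m - 1) = ff m k (6 * m - 2) ∧ ff m k (6 * m + 1) = ff m k (6 * m + 2) := by
  have h2 := m_eps hm
  have hg := cos_eps_gt hm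
  have hk2 := Nat.odd_iff.1 (Nat.not_even_iff_odd.1 hk)
  have o : ∀ c, c % 2 = 1 → rho m c = 2 * Real.cos (eps m) := fun c hc => by
    unfold rho; rw [if_neg (by rw [Nat.even_iff]; omega)]
  have e : ∀ c, c % 2 = 0 → rho m c = 1 := fun c hc => by
    unfold rho; rw [if_pos (Nat.even_iff.2 hc)]
  unfold ff
  rw [e (k + (6 * m - 1)) (by omega), o (k + (6 * m - 2)) (by omega), e (k + (6 * m + 1)) (by omega),
    o (k + (6 * m + 2)) (by omega)]
  have a1 : ((6 * m - 1 : ℕ) : ℝ) * eps m = Real.pi / 2 - eps m := by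
    rw [Nat.cast_sub (by omega)]
    push_cast; linear_combination 6 * h2
  have a2 : ((6 * m - 2 : ℕ) : ℝ) * eps m = Real.pi / 2 - 2 * eps m := by
    rw [Nat.cast_sub (by omega)]
    push_cast; linear_combination 6 * h2
  have a3 : ((6 * m + 1 : ℕ) : ℝ) * eps m = eps m + Real.pi / 2 := by
    push_cast; linear_combination 6 * h2
  have a4 : ((6 * m + 2 : ℕ) : ℝ) * eps m = 2 * eps m + Real.pi / 2 := by
    push_cast; linear_combination 6 * h2
  rw [a1, a2, a3, a4, Real.cos_pi_div_two_sub, Real.cos_pi_div_two_sub, Real.cos_add_pi_div_two,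
    Real.cos_add_pi_div_two, Real.sin_two_mul]
  constructor <;> field_simp

theorem card_image_le_sub_two {N : ℕ} (f : ℕ → ℝ) {a b a' b' : ℕ} (ha : a < N) (hb : b < N)
    (ha' : a' < N) (hb' : b' < N) (hab : a ≠ b) (h1 : a' ≠ a) (h2 : a' ≠ b) (h3 : b' ≠ a)
    (h4 : b' ≠ b) (ea : f a = f a') (eb : f b = f b') (W : Finset ℝ)
    (hW : ∀ w ∈ W, ∃ d < N, w = f d) : W.card ≤ N - 2 := by
  have hsub : W ⊆ (((Finset.range N).erase a).erase b).image f := by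
    intro w hw
    obtain ⟨d, hd, rfl⟩ := hW w hw
    simp only [Finset.mem_image, Finset.mem_erase, Finset.mem_range]
    by_cases hda : d = a
    · exact ⟨a', ⟨h2, h1, ha'⟩, by rw [hda, ea]⟩
    · by_cases hdb : d = b
      · exact ⟨b', ⟨h4, h3, hb'⟩, by rw [hdb, eb]⟩
      · exact ⟨d, ⟨hdb, hda, hd⟩, rfl⟩
  refine (Finset.card_le_card hsub).trans (Finset.card_image_le.trans ?_)
  rw [Finset.card_erase_of_mem, Finset.card_erase_of_mem, Finset.card_range]
  · omega
  · simpa using ha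
  · simp only [Finset.mem_erase, Finset.mem_range]
    exact ⟨hab.symm, hb⟩

theorem card_WW {m : ℕ} (hm : 1 ≤ m) {k : ℕ} (hk : k < 12 * m) :
    (WW m k).card ≤ 12 * m - 2 := by
  have hW : ∀ w ∈ WW m k, ∃ d < 12 * m, w = ff m k d := by
    intro w hw
    simp only [WW, Finset.mem_image, Finset.mem_erase, Finset.mem_range] at hw
    obtain ⟨c, ⟨h1, h2⟩, rfl⟩ := hw
    exact vv_eq_ff hm hk h2 h1
  by_cases he : Even k
  · obtain ⟨h1, h2⟩ := ff_even hm he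
    exact card_image_le_sub_two (ff m k) (by omega) (by omega) (by omega) (by omega) (by omega)
      (by omega) (by omega) (by omega) (by omega) h1 h2 _ hW
  · obtain ⟨h1, h2⟩ := ff_odd hm he
    exact card_image_le_sub_two (ff m k) (by omega) (by omega) (by omega) (by omega) (by omega)
      (by omega) (by omega) (by omega) (by omega) h1 h2 _ hW

/-- The completed sets of inverse radii. -/
theorem exists_fill {m : ℕ} (hm : 1 ≤ m) {k : ℕ} (hk : k < 12 * m) :
    ∃ W : Finset ℝ, W.card = 12 * m - 2 ∧ 0 ∈ W ∧
      ∀ c < 24 * m, (vv m k c ∈ W ↔ c ≠ k + 12 * m) := by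
  obtain ⟨t, ht, htc⟩ :=
    (Set.Ioi_infinite (1 : ℝ)).exists_subset_card_eq (12 * m - 2 - (WW m k).card)
  have ht' : ∀ k c, vv m k c ∉ t := fun k c h => absurd (ht h) (not_lt.2 (vv_le hm k c))
  have hW : ∀ c < 24 * m, (vv m k c ∈ WW m k ↔ c ≠ k + 12 * m) := by
    intro c hc
    constructor
    · rintro h rfl
      simp only [WW, Finset.mem_image, Finset.mem_erase, Finset.mem_range] at h
      obtain ⟨c', ⟨h1, h2⟩, h3⟩ := h
      exact vv_ne hm hk h2 h1 h3
    · intro h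
      exact Finset.mem_image_of_mem _ (Finset.mem_erase.2 ⟨h, Finset.mem_range.2 hc⟩)
  refine ⟨WW m k ∪ t, ?_, ?_, ?_⟩
  · rw [Finset.card_union_of_disjoint, htc]
    · have := card_WW hm hk
      omega
    · rw [Finset.disjoint_left]
      intro w hw
      simp only [WW, Finset.mem_image] at hw
      obtain ⟨c, -, rfl⟩ := hw
      exact ht' k c
  · apply Finset.mem_union_left
    rw [← vv_zero hm k]
    exact (hW _ (by omega)).2 (by omega)
  · intro c hc
    rw [Finset.mem_union, hW c hc]
    simp [ht' k c]

theorem sin_ne_of_lt {m : ℕ} (hm : 1 ≤ m) {k l : ℕ} (hk : k < 12 * m) (hl : l < 12 * m)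
    (h : Real.sin ((k : ℝ) * eps m - l * eps m) = 0) : k = l := by
  have h0 := eps_pos hm
  have h2 := m_eps hm
  have hk' : (k : ℝ) < 12 * m := by exact_mod_cast hk
  have hl' : (l : ℝ) < 12 * m := by exact_mod_cast hl
  have hk0 : (0 : ℝ) ≤ k := Nat.cast_nonneg k
  have hl0 : (0 : ℝ) ≤ l := Nat.cast_nonneg l
  rw [Real.sin_eq_zero_iff_of_lt_of_lt (by nlinarith) (by nlinarith)] at h
  have : (k : ℝ) = l := by
    apply mul_right_cancel₀ h0.ne'
    linarith
  exact_mod_cast this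

theorem angle_inj {m : ℕ} (hm : 1 ≤ m) {k l : ℕ} (hk : k < 24 * m) (hl : l < 24 * m)
    (hc : Real.cos (k * eps m) = Real.cos (l * eps m))
    (hs : Real.sin (k * eps m) = Real.sin (l * eps m)) : k = l := by
  have h0 := eps_pos hm
  have h2 := m_eps hm
  have hk' : (k : ℝ) < 24 * m := by exact_mod_cast hk
  have hl' : (l : ℝ) < 24 * m := by exact_mod_cast hl
  have hk0 : (0 : ℝ) ≤ k := Nat.cast_nonneg k
  have hl0 : (0 : ℝ) ≤ l := Nat.cast_nonneg l
  have h1 : Real.cos ((k : ℝ) * eps m - l * eps m) = 1 := by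
    rw [Real.cos_sub, hc, hs]
    nlinarith [Real.sin_sq_add_cos_sq (l * eps m)]
  rw [Real.cos_eq_one_iff_of_lt_of_lt (by nlinarith) (by nlinarith)] at h1
  have : (k : ℝ) = l := by
    apply mul_right_cancel₀ h0.ne'
    linarith
  exact_mod_cast this

theorem cos_half_ne {m : ℕ} (hm : 1 ≤ m) (k : ℕ) :
    Real.cos ((k : ℝ) * eps m - eps m / 2) ≠ 0 := by
  intro h
  rw [Real.cos_eq_zero_iff] at h
  obtain ⟨z, hz⟩ := h
  have h2 := m_eps hm
  have h0 := eps_pos hm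
  have h3 : ((2 * k - 1 : ℤ) : ℝ) = ((2 * z + 1) * (12 * m) : ℤ) := by
    apply mul_right_cancel₀ h0.ne'
    push_cast
    linear_combination 2 * hz - 12 * (2 * z + 1) * h2
  have h4 : (2 * k - 1 : ℤ) = (2 * z + 1) * (12 * m) := by exact_mod_cast h3
  have h5 : (2 * z + 1) * (12 * m : ℤ) = 2 * ((2 * z + 1) * (6 * m)) := by ring
  omega

/-- Denominator of the projective chart. -/
noncomputable def den (m : ℕ) (M : ℝ) (k : ℕ) (w : ℝ) : ℝ :=
  w + M * Real.cos ((k : ℝ) * eps m - eps m / 2)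

/-- The point on axis `k` with inverse radius `w`, in the chart. -/
noncomputable def PP (m : ℕ) (M : ℝ) (k : ℕ) (w : ℝ) : ℝ × ℝ :=
  (Real.cos (k * eps m) / den m M k w, Real.sin (k * eps m) / den m M k w)

/-- The line with homogeneous equation `a X + b Y + c W = 0`, in the chart. -/
noncomputable def LL (m : ℕ) (M a b c : ℝ) : AffineSubspace ℝ (ℝ × ℝ) :=
  lineOf (a - c * (M * Real.cos (eps m / 2))) (b - c * (M * Real.sin (eps m / 2))) c

theorem mem_LL {m : ℕ} {M a b c : ℝ} {k : ℕ} {w : ℝ} (h : den m M k w ≠ 0) :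
    PP m M k w ∈ LL m M a b c ↔
      a * Real.cos (k * eps m) + b * Real.sin (k * eps m) + c * w = 0 := by
  unfold LL PP
  rw [mem_lineOf]
  have hd : den m M k w = w + M * (Real.cos (k * eps m) * Real.cos (eps m / 2) +
      Real.sin (k * eps m) * Real.sin (eps m / 2)) := by
    unfold den
    rw [Real.cos_sub]
  have key : (a - c * (M * Real.cos (eps m / 2))) * (Real.cos (k * eps m) / den m M k w) +
      (b - c * (M * Real.sin (eps m / 2))) * (Real.sin (k * eps m) / den m M k w) + c =
      (a * Real.cos (k * eps m) + b * Real.sin (k * eps m) + c * w) / den m M k w := by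
    field_simp
    rw [hd]
    ring
  simp only
  rw [key, div_eq_zero_iff]
  simp [h]

theorem zero_mem_LL {m : ℕ} {M a b c : ℝ} : (0 : ℝ × ℝ) ∈ LL m M a b c ↔ c = 0 := by
  unfold LL
  rw [mem_lineOf]
  simp

theorem LL_cross {m : ℕ} {M a b c a' b' c' : ℝ}
    (h : ¬ (a - c * (M * Real.cos (eps m / 2)) = 0 ∧ b - c * (M * Real.sin (eps m / 2)) = 0))
    (he : LL m M a b c = LL m M a' b' c') :
    a * b' = a' * b ∧ a * c' = a' * c ∧ b * c' = b' * c := by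
  obtain ⟨h1, h2, h3⟩ := lineOf_cross h he
  have h2' : a * c' = a' * c := by linear_combination h2
  have h3' : b * c' = b' * c := by linear_combination h3
  refine ⟨?_, h2', h3'⟩
  linear_combination h1 + (M * Real.sin (eps m / 2)) * h2' - (M * Real.cos (eps m / 2)) * h3'

theorem PP_ne_zero {m : ℕ} {M : ℝ} {k : ℕ} {w : ℝ} (h : den m M k w ≠ 0) : PP m M k w ≠ 0 := by
  intro h0
  have := (mem_LL (a := 0) (b := 0) (c := 0) h)
  unfold PP at h0
  rw [Prod.mk_eq_zero, div_eq_zero_iff, div_eq_zero_iff] at h0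
  have h1 := h0.1.resolve_right h
  have h2 := h0.2.resolve_right h
  have := Real.sin_sq_add_cos_sq (k * eps m)
  rw [h1, h2] at this
  norm_num at this

theorem PP_inj {m : ℕ} (hm : 1 ≤ m) {M : ℝ} {k l : ℕ} (hk : k < 12 * m) (hl : l < 12 * m)
    {w z : ℝ} (h : den m M k w ≠ 0) (h' : den m M l z ≠ 0) (he : PP m M k w = PP m M l z) :
    k = l ∧ w = z := by
  have e1 : Real.sin ((k : ℝ) * eps m - l * eps m) = 0 := by
    have m1 : PP m M l z ∈ LL m M (-Real.sin (l * eps m)) (Real.cos (l * eps m)) 0 := by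
      rw [mem_LL h']
      ring
    rw [← he, mem_LL h] at m1
    rw [Real.sin_sub]
    linear_combination m1
  have e2 := sin_ne_of_lt hm hk hl e1
  subst e2
  refine ⟨rfl, ?_⟩
  have m1 : PP m M k z ∈ LL m M (z * Real.cos (k * eps m)) (z * Real.sin (k * eps m)) (-1) := by
    rw [mem_LL h']
    linear_combination z * Real.sin_sq_add_cos_sq (k * eps m)
  rw [← he, mem_LL h] at m1
  linear_combination z * Real.sin_sq_add_cos_sq (k * eps m) - m1

/-- The side lines. -/
noncomputable def sideL (m : ℕ) (M : ℝ) (c : ℕ) : AffineSubspace ℝ (ℝ × ℝ) :=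
  LL m M (Real.cos (c * eps m)) (Real.sin (c * eps m)) (-rho m c)

/-- The axes. -/
noncomputable def axisL (m : ℕ) (M : ℝ) (k : ℕ) : AffineSubspace ℝ (ℝ × ℝ) :=
  LL m M (-Real.sin (k * eps m)) (Real.cos (k * eps m)) 0

/-- The line at infinity. -/
noncomputable def infL (m : ℕ) (M : ℝ) : AffineSubspace ℝ (ℝ × ℝ) := LL m M 0 0 1

theorem side_nd {m : ℕ} (hm : 1 ≤ m) {M : ℝ} (hM : 1 < M) (c : ℕ) :
    ¬ (Real.cos (c * eps m) - (-rho m c) * (M * Real.cos (eps m / 2)) = 0 ∧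
      Real.sin (c * eps m) - (-rho m c) * (M * Real.sin (eps m / 2)) = 0) := by
  rintro ⟨h1, h2⟩
  have hr := rho_ge hm c
  have h3 : 1 < rho m c * M := by nlinarith
  have e1 : Real.cos (c * eps m) = -(rho m c * M) * Real.cos (eps m / 2) := by linarith
  have e2 : Real.sin (c * eps m) = -(rho m c * M) * Real.sin (eps m / 2) := by linarith
  have := Real.sin_sq_add_cos_sq (c * eps m)
  rw [e1, e2] at this
  have h4 : (rho m c * M) ^ 2 = 1 := by
    linear_combination this - (rho m c * M) ^ 2 * Real.sin_sq_add_cos_sq (eps m / 2)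
  nlinarith

theorem axis_nd {m : ℕ} {M : ℝ} (k : ℕ) :
    ¬ (-Real.sin (k * eps m) - 0 * (M * Real.cos (eps m / 2)) = 0 ∧
      Real.cos (k * eps m) - 0 * (M * Real.sin (eps m / 2)) = 0) := by
  rintro ⟨h1, h2⟩
  have := Real.sin_sq_add_cos_sq (k * eps m)
  nlinarith

theorem inf_nd {m : ℕ} {M : ℝ} (hM : 1 < M) :
    ¬ ((0 : ℝ) - 1 * (M * Real.cos (eps m / 2)) = 0 ∧
      (0 : ℝ) - 1 * (M * Real.sin (eps m / 2)) = 0) := by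
  rintro ⟨h1, h2⟩
  have h3 : M * Real.cos (eps m / 2) = 0 := by linarith
  have h4 : M * Real.sin (eps m / 2) = 0 := by linarith
  have h5 : M ^ 2 = 0 := by
    linear_combination (M * Real.cos (eps m / 2)) * h3 + (M * Real.sin (eps m / 2)) * h4 -
      M ^ 2 * Real.sin_sq_add_cos_sq (eps m / 2)
  nlinarith

theorem side_inj {m : ℕ} (hm : 1 ≤ m) {M : ℝ} (hM : 1 < M) {c d : ℕ} (hc : c < 24 * m)
    (hd : d < 24 * m) (h : sideL m M c = sideL m M d) : c = d := by
  obtain ⟨-, h2, h3⟩ := LL_cross (side_nd hm hM c) h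
  have r1 := rho_ge hm c
  have r2 := rho_ge hm d
  have s1 := Real.sin_sq_add_cos_sq (c * eps m)
  have s2 := Real.sin_sq_add_cos_sq (d * eps m)
  have h4 : rho m d ^ 2 = rho m c ^ 2 := by
    linear_combination (-rho m d * Real.cos (c * eps m) - rho m c * Real.cos (d * eps m)) * h2 +
      (-rho m d * Real.sin (c * eps m) - rho m c * Real.sin (d * eps m)) * h3 +
      rho m c ^ 2 * s2 - rho m d ^ 2 * s1
  have h5 : rho m d = rho m c := by
    rwa [sq_eq_sq₀ (by linarith) (by linarith)] at h4
  rw [h5] at h2 h3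
  have hne : -rho m c ≠ 0 := by linarith
  exact angle_inj hm hc hd (mul_right_cancel₀ hne h2) (mul_right_cancel₀ hne h3)

theorem side_ne_axis {m : ℕ} (hm : 1 ≤ m) {M : ℝ} (c k : ℕ) : sideL m M c ≠ axisL m M k := by
  intro h
  have h1 : (0 : ℝ × ℝ) ∈ axisL m M k := zero_mem_LL.2 rfl
  rw [← h] at h1
  have := zero_mem_LL.1 h1
  linarith [rho_ge hm c]

theorem axis_inj {m : ℕ} (hm : 1 ≤ m) {M : ℝ} {k l : ℕ} (hk : k < 12 * m) (hl : l < 12 * m)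
    (h : axisL m M k = axisL m M l) : k = l := by
  obtain ⟨h1, -, -⟩ := LL_cross (axis_nd k) h
  apply sin_ne_of_lt hm hk hl
  rw [Real.sin_sub]
  linear_combination -h1

theorem side_ne_inf {m : ℕ} (hm : 1 ≤ m) {M : ℝ} (hM : 1 < M) (c : ℕ) :
    sideL m M c ≠ infL m M := by
  intro h
  obtain ⟨-, h2, h3⟩ := LL_cross (side_nd hm hM c) h
  have := Real.sin_sq_add_cos_sq (c * eps m)
  nlinarith

theorem exists_M {m : ℕ} (hm : 1 ≤ m) (W : ℕ → Finset ℝ) :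
    ∃ M : ℝ, 1 < M ∧ ∀ k < 12 * m, ∀ w ∈ W k, den m M k w ≠ 0 := by
  classical
  let B : Finset ℝ := (Finset.range (12 * m)).biUnion fun k =>
    (W k).image fun w => -w / Real.cos ((k : ℝ) * eps m - eps m / 2)
  obtain ⟨M, hM, hB⟩ := (Set.Ioi_infinite (1 : ℝ)).exists_notMem_finset B
  refine ⟨M, hM, fun k hk w hw h0 => hB ?_⟩
  simp only [B, Finset.mem_biUnion, Finset.mem_range, Finset.mem_image]
  refine ⟨k, hk, w, hw, ?_⟩
  have := cos_half_ne hm k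
  unfold den at h0
  rw [div_eq_iff this]
  linarith

theorem main_config {m : ℕ} (hm : 1 ≤ m) :
    ∃ S : Finset (ℝ × ℝ), S.card = (12 * m - 1) ^ 2 ∧ ∃ M : ℝ, 1 < M ∧
      (∀ c < 12 * m, ((sideL m M c : Set (ℝ × ℝ)) ∩ ↑S).ncard = 12 * m) ∧
      (∀ c < 12 * m, ((sideL m M (c + 12 * m) : Set (ℝ × ℝ)) ∩ ↑S).ncard = 12 * m - 1) ∧
      (∀ c < 12 * m, ((axisL m M c : Set (ℝ × ℝ)) ∩ ↑S).ncard = 12 * m - 1) ∧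
      ((infL m M : Set (ℝ × ℝ)) ∩ ↑S).ncard = 12 * m := by
  classical
  have hW : ∀ k, ∃ W : Finset ℝ, k < 12 * m → (W.card = 12 * m - 2 ∧ 0 ∈ W ∧
      ∀ c < 24 * m, (vv m k c ∈ W ↔ c ≠ k + 12 * m)) := by
    intro k
    by_cases hk : k < 12 * m
    · obtain ⟨W, h⟩ := exists_fill hm hk
      exact ⟨W, fun _ => h⟩
    · exact ⟨∅, fun h => absurd h hk⟩
  choose W hW using hW
  obtain ⟨M, hM, hden⟩ := exists_M hm W
  let I : Finset (Σ _ : ℕ, ℝ) := (Finset.range (12 * m)).sigma W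
  let Q : (Σ _ : ℕ, ℝ) → ℝ × ℝ := fun x => PP m M x.1 x.2
  have hQ : Set.InjOn Q I := by
    rintro ⟨k, w⟩ h1 ⟨l, z⟩ h2 h
    simp only [I, Finset.coe_sigma, Set.mem_sigma_iff, Finset.mem_coe, Finset.mem_range] at h1 h2
    obtain ⟨rfl, rfl⟩ := PP_inj hm h1.1 h2.1 (hden _ h1.1 _ h1.2) (hden _ h2.1 _ h2.2) h
    rfl
  have h0 : (0 : ℝ × ℝ) ∉ I.image Q := by
    rw [Finset.mem_image]
    rintro ⟨⟨k, w⟩, h1, h2⟩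
    simp only [I, Finset.mem_sigma, Finset.mem_range] at h1
    exact PP_ne_zero (hden _ h1.1 _ h1.2) h2
  have hmemS : ∀ p, p ∈ insert 0 (I.image Q) ↔
      p = 0 ∨ ∃ k < 12 * m, ∃ w ∈ W k, p = PP m M k w := by
    intro p
    rw [Finset.mem_insert, Finset.mem_image]
    constructor
    · rintro (h | ⟨⟨k, w⟩, h1, h2⟩)
      · exact Or.inl h
      · simp only [I, Finset.mem_sigma, Finset.mem_range] at h1
        exact Or.inr ⟨k, h1.1, w, h1.2, h2.symm⟩
    · rintro (h | ⟨k, hk, w, hw, h⟩)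
      · exact Or.inl h
      · exact Or.inr ⟨⟨k, w⟩, by simp [I, hk, hw], h.symm⟩
  -- membership in the lines
  have hside : ∀ c k w, k < 12 * m → w ∈ W k →
      (PP m M k w ∈ sideL m M c ↔ w = vv m k c) := by
    intro c k w hk hw
    have hr := rho_ge hm c
    unfold sideL vv
    rw [mem_LL (hden k hk w hw), eq_div_iff (by linarith), sub_mul, Real.cos_sub]
    constructor <;> intro h <;> linarith
  have haxis : ∀ c k w, c < 12 * m → k < 12 * m → w ∈ W k →
      (PP m M k w ∈ axisL m M c ↔ k = c) := by
    intro c k w hc hk hw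
    unfold axisL
    rw [mem_LL (hden k hk w hw)]
    constructor
    · intro h
      apply sin_ne_of_lt hm hk hc
      rw [Real.sin_sub]
      linarith
    · rintro rfl
      ring
  have hinf : ∀ k w, k < 12 * m → w ∈ W k → (PP m M k w ∈ infL m M ↔ w = 0) := by
    intro k w hk hw
    unfold infL
    rw [mem_LL (hden k hk w hw)]
    simp
  -- counting lemma
  have count : ∀ (l : AffineSubspace ℝ (ℝ × ℝ)) (K : Finset ℕ) (g : ℕ → ℝ),
      (0 : ℝ × ℝ) ∉ l → (∀ k ∈ K, k < 12 * m ∧ g k ∈ W k) →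
      (∀ k w, k < 12 * m → w ∈ W k → (PP m M k w ∈ l ↔ k ∈ K ∧ w = g k)) →
      ((l : Set (ℝ × ℝ)) ∩ ↑(insert 0 (I.image Q))).ncard = K.card := by
    intro l K g hl hK hmem
    have : ((l : Set (ℝ × ℝ)) ∩ ↑(insert 0 (I.image Q))) =
        ↑(K.image fun k => PP m M k (g k)) := by
      ext p
      rw [Set.mem_inter_iff, Finset.mem_coe, hmemS, Finset.mem_coe, Finset.mem_image,
        SetLike.mem_coe]
      constructor
      · rintro ⟨h1, rfl | ⟨k, hk, w, hw, rfl⟩⟩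
        · exact absurd h1 hl
        · obtain ⟨h2, rfl⟩ := (hmem k w hk hw).1 h1
          exact ⟨k, h2, rfl⟩
      · rintro ⟨k, hk, rfl⟩
        obtain ⟨h1, h2⟩ := hK k hk
        exact ⟨(hmem k _ h1 h2).2 ⟨hk, rfl⟩, Or.inr ⟨k, h1, _, h2, rfl⟩⟩
    rw [this, Set.ncard_coe_finset, Finset.card_image_of_injOn]
    intro k hk l hl h
    obtain ⟨h1, h2⟩ := hK k hk
    obtain ⟨h3, h4⟩ := hK l hl
    exact (PP_inj hm h1 h3 (hden _ h1 _ h2) (hden _ h3 _ h4) h).1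
  have hzside : ∀ c, (0 : ℝ × ℝ) ∉ sideL m M c := by
    intro c h
    have := zero_mem_LL.1 h
    linarith [rho_ge hm c]
  refine ⟨insert 0 (I.image Q), ?_, M, hM, ?_, ?_, ?_, ?_⟩
  · rw [Finset.card_insert_of_notMem h0, Finset.card_image_of_injOn hQ, Finset.card_sigma,
      Finset.sum_congr rfl (fun k hk => (hW k (Finset.mem_range.1 hk)).1), Finset.sum_const,
      Finset.card_range, smul_eq_mul]
    obtain ⟨j, hj⟩ : ∃ j, 12 * m = j + 2 := ⟨12 * m - 2, by omega⟩
    rw [hj]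
    simp only [Nat.add_sub_cancel, show j + 2 - 1 = j + 1 by omega]
    ring
  · intro c hc
    rw [count (sideL m M c) (Finset.range (12 * m)) (fun k => vv m k c) (hzside c),
      Finset.card_range]
    · intro k hk
      have hk := Finset.mem_range.1 hk
      exact ⟨hk, ((hW k hk).2.2 c (by omega)).2 (by omega)⟩
    · intro k w hk hw
      rw [hside c k w hk hw]
      simp [hk]
  · intro c hc
    rw [count (sideL m M (c + 12 * m)) ((Finset.range (12 * m)).erase c)
      (fun k => vv m k (c + 12 * m)) (hzside _),
      Finset.card_erase_of_mem (Finset.mem_range.2 hc), Finset.card_range]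
    · intro k hk
      obtain ⟨h1, hk⟩ := Finset.mem_erase.1 hk
      have hk := Finset.mem_range.1 hk
      exact ⟨hk, ((hW k hk).2.2 _ (by omega)).2 (by omega)⟩
    · intro k w hk hw
      rw [hside _ k w hk hw, Finset.mem_erase, Finset.mem_range]
      constructor
      · intro h
        refine ⟨⟨?_, hk⟩, h⟩
        rw [h] at hw
        have := ((hW k hk).2.2 _ (by omega)).1 hw
        omega
      · exact fun h => h.2
  · intro c hc
    have : ((axisL m M c : Set (ℝ × ℝ)) ∩ ↑(insert 0 (I.image Q))) =
        ↑(insert 0 ((W c).image fun w => PP m M c w)) := by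
      ext p
      rw [Set.mem_inter_iff, Finset.mem_coe, hmemS, Finset.mem_coe, Finset.mem_insert,
        Finset.mem_image, SetLike.mem_coe]
      constructor
      · rintro ⟨h1, rfl | ⟨k, hk, w, hw, rfl⟩⟩
        · exact Or.inl rfl
        · obtain rfl := (haxis c k w hc hk hw).1 h1
          exact Or.inr ⟨w, hw, rfl⟩
      · rintro (rfl | ⟨w, hw, rfl⟩)
        · exact ⟨zero_mem_LL.2 rfl, Or.inl rfl⟩
        · exact ⟨(haxis c c w hc hc hw).2 rfl, Or.inr ⟨c, hc, w, hw, rfl⟩⟩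
    rw [this, Set.ncard_coe_finset, Finset.card_insert_of_notMem, Finset.card_image_of_injOn,
      (hW c hc).1]
    · omega
    · intro w hw z hz h
      exact (PP_inj hm hc hc (hden _ hc _ hw) (hden _ hc _ hz) h).2
    · rw [Finset.mem_image]
      rintro ⟨w, hw, h⟩
      exact PP_ne_zero (hden _ hc _ hw) h
  · rw [count (infL m M) (Finset.range (12 * m)) (fun _ => 0), Finset.card_range]
    · intro h
      exact one_ne_zero (zero_mem_LL.1 h)
    · intro k hk
      have hk := Finset.mem_range.1 hk
      exact ⟨hk, (hW k hk).2.1⟩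
    · intro k w hk hw
      rw [hinf k w hk hw]
      simp [hk]

/-- For every integer `m ≥ 1`, setting `n = 12m − 1`, there exists a set `S` of `n²`
points in ℝ² with at least `2n+2` distinct lines each containing exactly `n` points of
`S`, and in addition at least `n+2` distinct lines each containing exactly `n+1` points
of `S`. -/
theorem twelve_m_minus_one_configuration (m : ℕ) (hm : 1 ≤ m) (n : ℕ) (hn : n = 12 * m - 1) :
    ∃ S : Finset (ℝ × ℝ), S.card = n ^ 2 ∧
      (∃ L₁ : Finset (AffineSubspace ℝ (ℝ × ℝ)), 2 * n + 2 ≤ L₁.card ∧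
        ∀ l ∈ L₁, IsLine l ∧ ((l : Set (ℝ × ℝ)) ∩ ↑S).ncard = n) ∧
      (∃ L₂ : Finset (AffineSubspace ℝ (ℝ × ℝ)), n + 2 ≤ L₂.card ∧
        ∀ l ∈ L₂, IsLine l ∧ ((l : Set (ℝ × ℝ)) ∩ ↑S).ncard = n + 1) := by
  subst hn
  classical
  obtain ⟨S, hS, M, hM, h1, h2, h3, h4⟩ := main_config hm
  refine ⟨S, hS, ⟨(Finset.range (12 * m)).image (fun c => sideL m M (c + 12 * m)) ∪
    (Finset.range (12 * m)).image (axisL m M), ?_, ?_⟩,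
    ⟨insert (infL m M) ((Finset.range (12 * m)).image (sideL m M)), ?_, ?_⟩⟩
  · rw [Finset.card_union_of_disjoint, Finset.card_image_of_injOn, Finset.card_image_of_injOn,
      Finset.card_range]
    · omega
    · intro k hk l hl h
      simp only [Finset.coe_range, Set.mem_Iio] at hk hl
      exact axis_inj hm hk hl h
    · intro k hk l hl h
      simp only [Finset.coe_range, Set.mem_Iio] at hk hl
      have := side_inj hm hM (by omega) (by omega) h
      omega
    · rw [Finset.disjoint_left]
      intro l hl hl'
      obtain ⟨c, -, rfl⟩ := Finset.mem_image.1 hl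
      obtain ⟨k, -, h⟩ := Finset.mem_image.1 hl'
      exact side_ne_axis hm _ _ h.symm
  · intro l hl
    rcases Finset.mem_union.1 hl with h | h
    · obtain ⟨c, hc, rfl⟩ := Finset.mem_image.1 h
      exact ⟨isLine_lineOf (side_nd hm hM _), h2 c (Finset.mem_range.1 hc)⟩
    · obtain ⟨c, hc, rfl⟩ := Finset.mem_image.1 h
      exact ⟨isLine_lineOf (axis_nd _), h3 c (Finset.mem_range.1 hc)⟩
  · rw [Finset.card_insert_of_notMem, Finset.card_image_of_injOn, Finset.card_range]
    · omega
    · intro k hk l hl h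
      simp only [Finset.coe_range, Set.mem_Iio] at hk hl
      exact side_inj hm hM (by omega) (by omega) h
    · intro h
      obtain ⟨c, -, h⟩ := Finset.mem_image.1 h
      exact side_ne_inf hm hM _ h
  · intro l hl
    rcases Finset.mem_insert.1 hl with rfl | h
    · exact ⟨isLine_lineOf (inf_nd hM), by rw [h4]; omega⟩
    · obtain ⟨c, hc, rfl⟩ := Finset.mem_image.1 h
      exact ⟨isLine_lineOf (side_nd hm hM _), by rw [h1 c (Finset.mem_range.1 hc)]; omega⟩
end

section
/- For every integer N ≥ 3 there exist N distinct pairwise parallel lines l₁, …, l_N in ℝ² and N+4 distinct lines λ₁, …, λ_{N+4}, none of which is parallel to the lines l_i, such that for every i the set of intersection points ⋃_{j} (l_i ∩ λ_j) contains at most N points. -/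
/-- Direction of a line spanned by one vector. -/
lemma brass_isLine (p v : ℝ × ℝ) (hv : v ≠ 0) :
    IsLine (AffineSubspace.mk' p (Submodule.span ℝ {v})) := by
  unfold IsLine
  rw [AffineSubspace.direction_mk']
  exact finrank_span_singleton hv

/-- Dual, purely arithmetical form: `N+4` integer points `(a j, b j)` and `N` integer directions `t i`. -/
lemma brass_aux (N : ℕ) (a b : Fin (N + 4) → ℤ) (t : Fin N → ℤ)
    (hab : ∀ j k, a j = a k → b j = b k → j = k) (ht : ∀ i k, t i = t k → i = k)
    (hc : ∀ i, (Finset.univ.image fun j => a j * t i + b j).card ≤ N) :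
    ∃ l : Fin N → AffineSubspace ℝ (ℝ × ℝ),
      ∃ lam : Fin (N + 4) → AffineSubspace ℝ (ℝ × ℝ),
        (∀ i, IsLine (l i)) ∧ Function.Injective l ∧
        (∀ i j, (l i).direction = (l j).direction) ∧
        (∀ j, IsLine (lam j)) ∧ Function.Injective lam ∧
        (∀ j i, (lam j).direction ≠ (l i).direction) ∧
        (∀ i, (⋃ j, ((l i : Set (ℝ × ℝ)) ∩ (lam j : Set (ℝ × ℝ)))).ncard ≤ N) := by
  have hl : ∀ (i : Fin N) (x : ℝ × ℝ),
      x ∈ AffineSubspace.mk' ((t i : ℝ), (0 : ℝ)) (Submodule.span ℝ {((0 : ℝ), (1 : ℝ))}) ↔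
        x.1 = t i := by
    rintro i ⟨x, y⟩
    rw [AffineSubspace.mem_mk', Submodule.mem_span_singleton]
    simp only [vsub_eq_sub, Prod.mk_sub_mk, Prod.smul_mk, smul_eq_mul, Prod.mk.injEq]
    constructor
    · rintro ⟨c, h1, h2⟩; linarith
    · intro h; exact ⟨y, by linarith, by ring⟩
  have hm : ∀ (j : Fin (N + 4)) (x : ℝ × ℝ),
      x ∈ AffineSubspace.mk' ((0 : ℝ), (b j : ℝ)) (Submodule.span ℝ {((1 : ℝ), (a j : ℝ))}) ↔
        x.2 = a j * x.1 + b j := by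
    rintro j ⟨x, y⟩
    rw [AffineSubspace.mem_mk', Submodule.mem_span_singleton]
    simp only [vsub_eq_sub, Prod.mk_sub_mk, Prod.smul_mk, smul_eq_mul, Prod.mk.injEq]
    constructor
    · rintro ⟨c, h1, h2⟩
      have : c = x := by linarith
      subst this; linarith
    · intro h; exact ⟨x, by ring, by linarith⟩
  refine ⟨fun i => AffineSubspace.mk' ((t i : ℝ), (0 : ℝ)) (Submodule.span ℝ {((0 : ℝ), (1 : ℝ))}),
    fun j => AffineSubspace.mk' ((0 : ℝ), (b j : ℝ)) (Submodule.span ℝ {((1 : ℝ), (a j : ℝ))}),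
    ?_, ?_, ?_, ?_, ?_, ?_, ?_⟩
  · intro i; exact brass_isLine _ _ (by simp)
  · intro i k h
    have h1 := (hl i ((t i : ℝ), 0)).2 rfl
    have h' := h
    simp only at h'
    rw [h', hl] at h1
    simp only at h1
    exact ht i k (by exact_mod_cast h1)
  · intro i j; simp [AffineSubspace.direction_mk']
  · intro i; exact brass_isLine _ _ (by simp)
  · intro j k h
    have h' := h
    simp only at h'
    have h1 := (hm j ((0 : ℝ), (b j : ℝ))).2 (by simp)
    have h2 := (hm j ((1 : ℝ), (a j + b j : ℝ))).2 (by simp)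
    rw [h', hm] at h1 h2
    simp only [mul_zero, zero_add, mul_one] at h1 h2
    exact hab j k (by
      have : (a j : ℝ) = a k := by linarith
      exact_mod_cast this) (by exact_mod_cast h1)
  · intro j i h
    rw [AffineSubspace.direction_mk', AffineSubspace.direction_mk'] at h
    have h1 : ((1 : ℝ), (a j : ℝ)) ∈ Submodule.span ℝ {((0 : ℝ), (1 : ℝ))} := by
      rw [← h]; exact Submodule.mem_span_singleton_self _
    rw [Submodule.mem_span_singleton] at h1
    obtain ⟨c, hc⟩ := h1
    simp at hc
  · intro i
    set F : Finset ℤ := Finset.univ.image fun j => a j * t i + b j with hF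
    have hsub : (⋃ j, ((AffineSubspace.mk' ((t i : ℝ), (0 : ℝ))
        (Submodule.span ℝ {((0 : ℝ), (1 : ℝ))}) : Set (ℝ × ℝ)) ∩
        (AffineSubspace.mk' ((0 : ℝ), (b j : ℝ))
          (Submodule.span ℝ {((1 : ℝ), (a j : ℝ))}) : Set (ℝ × ℝ)))) ⊆
        ((F.image fun z : ℤ => ((t i : ℝ), (z : ℝ)) : Finset (ℝ × ℝ)) : Set (ℝ × ℝ)) := by
      intro x hx
      rw [Set.mem_iUnion] at hx
      obtain ⟨j, hx1, hx2⟩ := hx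
      have e1 := (hl i x).1 hx1
      have e2 := (hm j x).1 hx2
      rw [Finset.mem_coe, Finset.mem_image]
      refine ⟨a j * t i + b j, Finset.mem_image.2 ⟨j, Finset.mem_univ _, rfl⟩, ?_⟩
      ext
      · exact e1.symm
      · rw [e2, e1]; push_cast; rfl
    calc _ ≤ _ := Set.ncard_le_ncard hsub (Finset.finite_toSet _)
      _ = _ := Set.ncard_coe_finset _
      _ ≤ F.card := Finset.card_image_le
      _ ≤ N := hc i

/-- Points on a parabola, `N ≥ 7`. -/
lemma brass_card (N : ℕ) (hN : 7 ≤ N) (i : Fin N) :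
    (Finset.univ.image fun j : Fin (N + 4) =>
      ((j : ℕ) : ℤ) * (((i : ℕ) : ℤ) + 7) + -(((j : ℕ) : ℤ) ^ 2)).card ≤ N := by
  have hi := i.2
  -- a block of `N` consecutive values of `j` already gives all values
  obtain ⟨c, hc⟩ : ∃ c : ℕ, ∀ j : ℕ, j < N + 4 →
      (c ≤ j ∧ j < c + N) ∨
        (j ≤ i + 7 ∧ c ≤ i + 7 - j ∧ i + 7 - j < c + N) := by
    by_cases h : (i : ℕ) + 7 ≤ N + 3
    · exact ⟨4, fun j hj => by omega⟩
    · exact ⟨0, fun j hj => by omega⟩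
  have hsub : (Finset.univ.image fun j : Fin (N + 4) =>
      ((j : ℕ) : ℤ) * (((i : ℕ) : ℤ) + 7) + -(((j : ℕ) : ℤ) ^ 2)) ⊆
      (Finset.Ico c (c + N)).image fun j : ℕ =>
        (j : ℤ) * (((i : ℕ) : ℤ) + 7) + -((j : ℤ) ^ 2) := by
    intro z hz
    obtain ⟨j, -, rfl⟩ := Finset.mem_image.1 hz
    rw [Finset.mem_image]
    rcases hc j j.2 with h | ⟨h1, h2, h3⟩
    · exact ⟨j, Finset.mem_Ico.2 h, rfl⟩
    · refine ⟨i + 7 - j, Finset.mem_Ico.2 ⟨h2, h3⟩, ?_⟩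
      rw [Nat.cast_sub h1]
      push_cast
      ring
  calc _ ≤ _ := Finset.card_le_card hsub
    _ ≤ (Finset.Ico c (c + N)).card := Finset.card_image_le
    _ = N := by simp


/-- For every integer N ≥ 3 there are N distinct parallel lines and N+4 Brass transversals: lines not parallel to the former, whose union meets each of the N parallel lines in at most N points. -/
theorem brass_transversals_N_plus_four (N : ℕ) (hN : 3 ≤ N) :
    ∃ l : Fin N → AffineSubspace ℝ (ℝ × ℝ),
      ∃ lam : Fin (N + 4) → AffineSubspace ℝ (ℝ × ℝ),
        (∀ i, IsLine (l i)) ∧ Function.Injective l ∧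
        (∀ i j, (l i).direction = (l j).direction) ∧
        (∀ j, IsLine (lam j)) ∧ Function.Injective lam ∧
        (∀ j i, (lam j).direction ≠ (l i).direction) ∧
        (∀ i, (⋃ j, ((l i : Set (ℝ × ℝ)) ∩ (lam j : Set (ℝ × ℝ)))).ncard ≤ N) := by
  by_cases h7 : 7 ≤ N
  · exact brass_aux N (fun j => ((j : ℕ) : ℤ)) (fun j => -(((j : ℕ) : ℤ) ^ 2))
      (fun i => ((i : ℕ) : ℤ) + 7)
      (fun j k h _ => Fin.ext (by exact_mod_cast h))
      (fun i k h => Fin.ext (by simpa using h))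
      (brass_card N h7)
  have h6 : N ≤ 6 := by omega
  clear h7
  interval_cases N
  · exact brass_aux 3 ![0, 1, 2, -1, -2, -1, 1]
      ![0, 0, 2, 0, -2, -2, 2] ![0, -1, -2]
      (by decide) (by decide) (by decide)
  · exact brass_aux 4 ![1, 2, 2, 4, 5, 7, 7, 8]
      ![0, 0, 6, 12, 6, 12, 18, 18] ![0, -3, -6, -2]
      (by decide) (by decide) (by decide)
  · exact brass_aux 5 ![8, 3, 2, 5, 4, 7, 6, 1, 5]
      ![36, 12, 12, 12, 24, 24, 24, 0, 24] ![-4, -3, 0, -6, -12]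
      (by decide) (by decide) (by decide)
  · exact brass_aux 6 ![5, 4, 9, 7, 3, 4, 8, 0, 2, 5]
      ![120, 120, 180, 120, 60, 60, 180, 0, 0, 60] ![-24, -20, -15, 0, -30, -60]
      (by decide) (by decide) (by decide)
end

section
/- For every odd integer N ≥ 3 there exist N distinct pairwise parallel lines l₁, …, l_N in ℝ² and 2N+1 distinct lines λ₁, …, λ_{2N+1}, none of which is parallel to the lines l_i, such that for every i the set of intersection points ⋃_{j} (l_i ∩ λ_j) contains at most N points. -/
namespace Brass

open Real

/-- The vertical line at abscissa `x`. -/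
noncomputable def vert (x : ℝ) : AffineSubspace ℝ (ℝ × ℝ) :=
  AffineSubspace.mk' ((x, 0) : ℝ × ℝ) (Submodule.span ℝ {((0, 1) : ℝ × ℝ)})

/-- The line `y = m x + b`. -/
noncomputable def slant (m b : ℝ) : AffineSubspace ℝ (ℝ × ℝ) :=
  AffineSubspace.mk' ((0, b) : ℝ × ℝ) (Submodule.span ℝ {((1, m) : ℝ × ℝ)})

lemma mem_vert (x : ℝ) (q : ℝ × ℝ) : q ∈ vert x ↔ q.1 = x := by
  obtain ⟨u, v⟩ := q
  simp only [vert, AffineSubspace.mem_mk', Submodule.mem_span_singleton, vsub_eq_sub,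
    Prod.ext_iff, Prod.smul_fst, Prod.smul_snd, Prod.fst_sub, Prod.snd_sub, smul_eq_mul]
  constructor
  · rintro ⟨a, h1, h2⟩
    linarith
  · rintro rfl
    exact ⟨v, by ring, by ring⟩

lemma mem_slant (m b : ℝ) (q : ℝ × ℝ) : q ∈ slant m b ↔ q.2 = m * q.1 + b := by
  obtain ⟨u, v⟩ := q
  simp only [slant, AffineSubspace.mem_mk', Submodule.mem_span_singleton, vsub_eq_sub,
    Prod.ext_iff, Prod.smul_fst, Prod.smul_snd, Prod.fst_sub, Prod.snd_sub, smul_eq_mul]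
  constructor
  · rintro ⟨a, h1, h2⟩
    have : a = u := by linarith
    subst this
    linarith
  · intro h
    exact ⟨u, by ring, by rw [h]; ring⟩

lemma isLine_vert (x : ℝ) : IsLine (vert x) := by
  rw [IsLine, vert, AffineSubspace.direction_mk']
  exact finrank_span_singleton (by simp)

lemma isLine_slant (m b : ℝ) : IsLine (slant m b) := by
  rw [IsLine, slant, AffineSubspace.direction_mk']
  exact finrank_span_singleton (by simp)

lemma dir_ne (m b x : ℝ) : (slant m b).direction ≠ (vert x).direction := by
  rw [slant, vert, AffineSubspace.direction_mk', AffineSubspace.direction_mk']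
  intro h
  have h1 : ((1, m) : ℝ × ℝ) ∈ Submodule.span ℝ {((0, 1) : ℝ × ℝ)} := by
    rw [← h]; exact Submodule.mem_span_singleton_self _
  rw [Submodule.mem_span_singleton] at h1
  obtain ⟨a, ha⟩ := h1
  simp at ha

lemma vert_inj {x y : ℝ} (h : vert x = vert y) : x = y := by
  have : ((x, 0) : ℝ × ℝ) ∈ vert y := by rw [← h, mem_vert]
  simpa [mem_vert] using this

lemma slant_inj {m b m' b' : ℝ} (h : slant m b = slant m' b') : m = m' ∧ b = b' := by
  have h0 : ((0, b) : ℝ × ℝ) ∈ slant m' b' := by rw [← h, mem_slant]; simp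
  have h1 : ((1, m + b) : ℝ × ℝ) ∈ slant m' b' := by rw [← h, mem_slant]; simp
  rw [mem_slant] at h0 h1
  simp only at h0 h1
  constructor <;> linarith

lemma cos_red (N : ℕ) (hN : 0 < N) (n : ℤ) :
    ∃ t ∈ Finset.range N, cos (π * (2 * n + 1) / (2 * N)) = cos (π * (2 * t + 1) / (2 * N)) := by
  have hN' : (N : ℝ) ≠ 0 := by positivity
  have h2 : (0 : ℤ) < 2 * N := by omega
  have hr0 := Int.emod_nonneg n h2.ne'
  have hr1 := Int.emod_lt_of_pos n h2
  have hd := Int.emod_add_mul_ediv n (2 * N)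
  generalize n % (2 * N) = r at *
  generalize n / (2 * N) = q at *
  lift r to ℕ using hr0
  have key : cos (π * (2 * n + 1) / (2 * N)) = cos (π * (2 * r + 1) / (2 * N)) := by
    rw [← Real.cos_add_int_mul_two_pi (π * (2 * r + 1) / (2 * N)) q, ← hd]
    congr 1
    push_cast
    field_simp
    ring
  by_cases h : r < N
  · exact ⟨r, Finset.mem_range.2 h, key⟩
  · refine ⟨2 * N - 1 - r, Finset.mem_range.2 (by omega), ?_⟩
    rw [key, ← Real.cos_two_pi_sub]
    congr 1
    have h3 : ((2 * N - 1 - r : ℕ) : ℝ) = 2 * N - 1 - r := by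
      have : (2 * N - 1 - r : ℕ) + 1 + r = 2 * N := by omega
      have : (((2 * N - 1 - r : ℕ) : ℝ)) + 1 + r = 2 * N := by exact_mod_cast this
      linarith
    rw [h3]
    field_simp
    ring

end Brass

open Brass in
/-- For every odd integer N ≥ 3 there are N distinct parallel lines and 2N+1 Brass transversals: lines not parallel to the former, whose union meets each of the N parallel lines in at most N points. -/
theorem brass_transversals_odd (N : ℕ) (hN : 3 ≤ N) (hodd : Odd N) :
    ∃ l : Fin N → AffineSubspace ℝ (ℝ × ℝ),
      ∃ lam : Fin (2 * N + 1) → AffineSubspace ℝ (ℝ × ℝ),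
        (∀ i, IsLine (l i)) ∧ Function.Injective l ∧
        (∀ i j, (l i).direction = (l j).direction) ∧
        (∀ j, IsLine (lam j)) ∧ Function.Injective lam ∧
        (∀ j i, (lam j).direction ≠ (l i).direction) ∧
        (∀ i, (⋃ j, ((l i : Set (ℝ × ℝ)) ∩ (lam j : Set (ℝ × ℝ)))).ncard ≤ N) := by
  obtain ⟨M, hM⟩ := hodd
  have hMR : (N : ℝ) = 2 * M + 1 := by exact_mod_cast hM
  have hNpos : (0 : ℝ) < N := by positivity
  have hpi := Real.pi_pos
  let θ : ℕ → ℝ := fun i => Real.pi * ((i : ℝ) - M) / N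
  let φ : ℕ → ℝ := fun k => Real.pi * (2 * k + 1) / (2 * N)
  let m : ℕ → ℝ := fun k => if k < 2 * N then Real.sin (φ k) else 0
  let b : ℕ → ℝ := fun k => if k < 2 * N then Real.cos (φ k) else 0
  have hθ : ∀ i < N, θ i ∈ Set.Ioo (-(Real.pi / 2)) (Real.pi / 2) := by
    intro i hi
    have h1 : (i : ℝ) ≤ 2 * M := by exact_mod_cast (by omega : i ≤ 2 * M)
    have h0 : (0 : ℝ) ≤ i := by positivity
    constructor
    · change _ < Real.pi * ((i : ℝ) - M) / N
      rw [lt_div_iff₀ hNpos]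
      nlinarith
    · change Real.pi * ((i : ℝ) - M) / N < _
      rw [div_lt_iff₀ hNpos]
      nlinarith
  refine ⟨fun i => vert (Real.tan (θ i)), fun j => slant (m j) (b j), fun i => isLine_vert _, ?_,
    fun i j => by simp [vert], fun j => isLine_slant _ _, ?_, fun j i => dir_ne _ _ _, ?_⟩
  · intro i j h
    have h1 := Real.injOn_tan (hθ i i.2) (hθ j j.2) (vert_inj h)
    have h2 : Real.pi * (((i : ℕ) : ℝ) - M) / N = Real.pi * (((j : ℕ) : ℝ) - M) / N := h1
    field_simp at h2
    have h3 : ((i : ℕ) : ℝ) = ((j : ℕ) : ℝ) := by linarith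
    exact Fin.ext (by exact_mod_cast h3)
  · intro j k h
    obtain ⟨h1, h2⟩ := slant_inj h
    have hj := j.2
    have hk := k.2
    apply Fin.ext
    generalize (j : ℕ) = j at *
    generalize (k : ℕ) = k at *
    have hs1 := Real.sin_sq_add_cos_sq (φ j)
    have hs2 := Real.sin_sq_add_cos_sq (φ k)
    simp only [m, b] at h1 h2
    split_ifs at h1 h2 with hj' hk' hk'
    · have hc : Real.cos (φ j - φ k) = 1 := by
        rw [Real.cos_sub, h1, h2]; linarith
      have e : φ j - φ k = Real.pi * ((j : ℝ) - k) / N := by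
        simp only [φ]; field_simp; ring
      have a1 : (j : ℝ) < 2 * N := by exact_mod_cast hj'
      have a2 : (k : ℝ) < 2 * N := by exact_mod_cast hk'
      have a3 : (0 : ℝ) ≤ j := by positivity
      have a4 : (0 : ℝ) ≤ k := by positivity
      rw [Real.cos_eq_one_iff_of_lt_of_lt
        (by rw [e, lt_div_iff₀ hNpos]; nlinarith) (by rw [e, div_lt_iff₀ hNpos]; nlinarith), e] at hc
      have h5 : (j : ℝ) - k = 0 := by
        have := hpi.ne'
        have := hNpos.ne'
        simp_all
      have h3 : (j : ℝ) = k := by linarith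
      exact_mod_cast h3
    · rw [h1, h2] at hs1; norm_num at hs1
    · rw [← h1, ← h2] at hs2; norm_num at hs2
    · omega
  · intro i
    have hi := i.2
    beta_reduce
    generalize (i : ℕ) = i at *
    have hc : Real.cos (θ i) ≠ 0 := (Real.cos_pos_of_mem_Ioo (hθ i hi)).ne'
    let f : ℕ → ℝ × ℝ := fun t =>
      (Real.tan (θ i), Real.cos (Real.pi * (2 * t + 1) / (2 * N)) / Real.cos (θ i))
    have hsub : (⋃ j : Fin (2 * N + 1), ((vert (Real.tan (θ i)) : Set (ℝ × ℝ)) ∩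
        (slant (m j) (b j) : Set (ℝ × ℝ)))) ⊆ ((Finset.range N).image f : Finset (ℝ × ℝ)) := by
      intro q hq
      simp only [Set.mem_iUnion, Set.mem_inter_iff, SetLike.mem_coe, mem_vert, mem_slant] at hq
      obtain ⟨j, hq1, hq2⟩ := hq
      generalize (j : ℕ) = k at *
      rw [Finset.mem_coe, Finset.mem_image]
      by_cases hk : k < 2 * N
      · obtain ⟨t, ht, e⟩ := cos_red N (by omega) ((k : ℤ) - i + M)
        refine ⟨t, ht, Prod.ext hq1.symm ?_⟩
        simp only [f, m, b, if_pos hk] at hq2 ⊢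
        rw [← e, hq2, hq1]
        have e2 : Real.pi * (2 * (((k : ℤ) - i + M : ℤ) : ℝ) + 1) / (2 * N) = φ k - θ i := by
          simp only [φ, θ]; push_cast; field_simp; ring
        rw [e2, Real.cos_sub, Real.tan_eq_sin_div_cos]
        field_simp
        ring
      · refine ⟨M, Finset.mem_range.2 (by omega), Prod.ext hq1.symm ?_⟩
        simp only [f, m, b, if_neg hk] at hq2 ⊢
        have e2 : Real.pi * (2 * (M : ℝ) + 1) / (2 * N) = Real.pi / 2 := by
          rw [← hMR]; field_simp
        rw [e2, hq2, Real.cos_pi_div_two]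
        ring
    calc _ ≤ (((Finset.range N).image f : Finset (ℝ × ℝ)) : Set (ℝ × ℝ)).ncard :=
          Set.ncard_le_ncard hsub (Finset.finite_toSet _)
      _ = ((Finset.range N).image f).card := Set.ncard_coe_finset _
      _ ≤ N := by simpa using Finset.card_image_le (s := Finset.range N) (f := f)
end

section
/- For every even integer N ≥ 4 there exist N distinct pairwise parallel lines l₁, …, l_N in ℝ² and 2N distinct lines λ₁, …, λ_{2N}, none of which is parallel to the lines l_i, such that for every i the set of intersection points ⋃_{j} (l_i ∩ λ_j) contains at most N points. (The construction takes the N lines through the origin at angles (i/N)π, and the 2N lines parallel to these at unit distance, all rotated by the angle π/2N about the origin; then one projects the origin to infinity.) -/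
/-- The vertical line `x = t`. -/
noncomputable def vertL (t : ℝ) : AffineSubspace ℝ (ℝ × ℝ) :=
  AffineSubspace.mk' (t, 0) (Submodule.span ℝ {((0 : ℝ), (1 : ℝ))})

/-- The line `y = a + b x`. -/
noncomputable def slopeL (a b : ℝ) : AffineSubspace ℝ (ℝ × ℝ) :=
  AffineSubspace.mk' (0, a) (Submodule.span ℝ {((1 : ℝ), b)})

lemma mem_vertL (t : ℝ) (p : ℝ × ℝ) : p ∈ vertL t ↔ p.1 = t := by
  rw [vertL, AffineSubspace.mem_mk', Submodule.mem_span_singleton]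
  constructor
  · rintro ⟨c, hc⟩
    have := congrArg Prod.fst hc
    simp at this
    linarith
  · intro h
    refine ⟨p.2, ?_⟩
    ext <;> simp [h]

lemma mem_slopeL (a b : ℝ) (p : ℝ × ℝ) : p ∈ slopeL a b ↔ p.2 = a + b * p.1 := by
  rw [slopeL, AffineSubspace.mem_mk', Submodule.mem_span_singleton]
  constructor
  · rintro ⟨c, hc⟩
    have h1 := congrArg Prod.fst hc
    have h2 := congrArg Prod.snd hc
    simp at h1 h2
    rw [← h1]
    linarith
  · intro h
    refine ⟨p.1, ?_⟩
    ext
    · simp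
    · simp [h]; ring

lemma isLine_vertL (t : ℝ) : IsLine (vertL t) := by
  have h : (vertL t).direction = Submodule.span ℝ {((0 : ℝ), (1 : ℝ))} :=
    AffineSubspace.direction_mk' _ _
  unfold IsLine
  rw [h]
  exact finrank_span_singleton (by simp)

lemma isLine_slopeL (a b : ℝ) : IsLine (slopeL a b) := by
  have h : (slopeL a b).direction = Submodule.span ℝ {((1 : ℝ), b)} :=
    AffineSubspace.direction_mk' _ _
  unfold IsLine
  rw [h]
  exact finrank_span_singleton (by simp)

/-- The angle of the transversal with index `j`. -/
noncomputable def phiA (N : ℕ) (j : ℕ) : ℝ := Real.pi * j / N - Real.pi / 2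

/-- The angle of the parallel line with index `i`. -/
noncomputable def thetaA (N : ℕ) (i : ℕ) : ℝ := Real.pi * (2 * i + 1) / (2 * N) - Real.pi / 2

lemma theta_mem (N : ℕ) (hN : 4 ≤ N) (i : ℕ) (hi : i < N) :
    -(Real.pi / 2) < thetaA N i ∧ thetaA N i < Real.pi / 2 := by
  have hn : (0 : ℝ) < N := by exact_mod_cast (by omega : 0 < N)
  have hi' : (i : ℝ) + 1 ≤ N := by exact_mod_cast hi
  have hp := Real.pi_pos
  unfold thetaA
  constructor
  · have : 0 < Real.pi * (2 * i + 1) / (2 * N) := by positivity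
    linarith
  · have : Real.pi * (2 * i + 1) / (2 * N) < Real.pi := by
      rw [div_lt_iff₀ (by positivity)]
      nlinarith
    linarith

/-- The height at which transversal `j` meets the parallel line `i`. -/
noncomputable def hgt (N i j : ℕ) : ℝ :=
  Real.cos (phiA N j) + Real.sin (phiA N j) * Real.tan (thetaA N i)

lemma hgt_eq (N : ℕ) (hN : 4 ≤ N) (i j : ℕ) (hi : i < N) :
    hgt N i j = Real.cos (phiA N j - thetaA N i) / Real.cos (thetaA N i) := by
  have h := theta_mem N hN i hi
  have hc : Real.cos (thetaA N i) ≠ 0 := (Real.cos_pos_of_mem_Ioo ⟨h.1, h.2⟩).ne'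
  rw [hgt, Real.tan_eq_sin_div_cos, Real.cos_sub]
  field_simp

lemma hgt_refl (N : ℕ) (hN : 4 ≤ N) (i j : ℕ) (hi : i < N) (hj : j < 2 * N) (hodd : ¬ Even j) :
    ∃ k < N, hgt N i j = hgt N i (2 * k) := by
  obtain ⟨m, rfl⟩ := Nat.not_even_iff_odd.mp hodd
  have hn : (N : ℝ) ≠ 0 := by exact_mod_cast (by omega : N ≠ 0)
  by_cases hm : m ≤ i
  · refine ⟨i - m, by omega, ?_⟩
    rw [hgt_eq N hN _ _ hi, hgt_eq N hN _ _ hi, ← Real.cos_neg]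
    congr 2
    unfold phiA thetaA
    push_cast [Nat.cast_sub hm]
    field_simp
    ring
  · refine ⟨i + N - m, by omega, ?_⟩
    rw [hgt_eq N hN _ _ hi, hgt_eq N hN _ _ hi, ← Real.cos_neg, ← Real.cos_add_two_pi]
    congr 2
    unfold phiA thetaA
    push_cast [Nat.cast_sub (by omega : m ≤ i + N)]
    field_simp
    ring

lemma phi_inj (N : ℕ) (hN : 4 ≤ N) (j k : ℕ) (hj : j < 2 * N) (hk : k < 2 * N)
    (hc : Real.cos (phiA N j) = Real.cos (phiA N k))
    (hs : Real.sin (phiA N j) = Real.sin (phiA N k)) : j = k := by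
  have hn : (0 : ℝ) < N := by exact_mod_cast (by omega : 0 < N)
  have hp := Real.pi_pos
  have h1 : Real.cos (phiA N j - phiA N k) = 1 := by
    rw [Real.cos_sub, hc, hs]
    nlinarith [Real.sin_sq_add_cos_sq (phiA N k)]
  have e : phiA N j - phiA N k = Real.pi * ((j : ℝ) - k) / N := by
    unfold phiA
    ring
  have hj' : (j : ℝ) < 2 * N := by exact_mod_cast hj
  have hk' : (k : ℝ) < 2 * N := by exact_mod_cast hk
  have hj0 : (0 : ℝ) ≤ j := by positivity
  have hk0 : (0 : ℝ) ≤ k := by positivity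
  rw [Real.cos_eq_one_iff_of_lt_of_lt, e] at h1
  · have : (j : ℝ) - k = 0 := by
      have := hp.ne'
      have := hn.ne'
      simp_all
    exact_mod_cast (by linarith : (j : ℝ) = k)
  · rw [e, lt_div_iff₀ hn]
    nlinarith
  · rw [e, div_lt_iff₀ hn]
    nlinarith

/-- For every even integer N ≥ 4 there are N distinct parallel lines and 2N Brass transversals: lines not parallel to the former, whose union meets each of the N parallel lines in at most N points. -/
theorem brass_transversals_even (N : ℕ) (hN : 4 ≤ N) (heven : Even N) :
    ∃ l : Fin N → AffineSubspace ℝ (ℝ × ℝ),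
      ∃ lam : Fin (2 * N) → AffineSubspace ℝ (ℝ × ℝ),
        (∀ i, IsLine (l i)) ∧ Function.Injective l ∧
        (∀ i j, (l i).direction = (l j).direction) ∧
        (∀ j, IsLine (lam j)) ∧ Function.Injective lam ∧
        (∀ j i, (lam j).direction ≠ (l i).direction) ∧
        (∀ i, (⋃ j, ((l i : Set (ℝ × ℝ)) ∩ (lam j : Set (ℝ × ℝ)))).ncard ≤ N) := by
  have hn : (0 : ℝ) < N := by exact_mod_cast (by omega : 0 < N)
  refine ⟨fun i => vertL (Real.tan (thetaA N i)),
    fun j => slopeL (Real.cos (phiA N j)) (Real.sin (phiA N j)), ?_, ?_, ?_, ?_, ?_, ?_, ?_⟩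
  · intro i
    exact isLine_vertL _
  · intro i k h
    have h0 : ((Real.tan (thetaA N i), 0) : ℝ × ℝ) ∈ vertL (Real.tan (thetaA N k)) := by
      have h' : vertL (Real.tan (thetaA N i)) = vertL (Real.tan (thetaA N k)) := h
      rw [← h', mem_vertL]
    rw [mem_vertL] at h0
    have hi := theta_mem N hN i i.2
    have hk := theta_mem N hN k k.2
    have := Real.tan_inj_of_lt_of_lt_pi_div_two hi.1 hi.2 hk.1 hk.2 h0
    unfold thetaA at this
    have hp := Real.pi_pos.ne'
    field_simp at this
    ext
    exact_mod_cast (by linarith : ((i : ℕ) : ℝ) = (k : ℕ))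
  · intro i j
    simp only [vertL, AffineSubspace.direction_mk']
  · intro i
    exact isLine_slopeL _ _
  · intro j k h
    have h' : ∀ p, p ∈ slopeL (Real.cos (phiA N j)) (Real.sin (phiA N j)) →
        p ∈ slopeL (Real.cos (phiA N k)) (Real.sin (phiA N k)) := by
      intro p hp
      have h' : slopeL (Real.cos (phiA N j)) (Real.sin (phiA N j)) =
        slopeL (Real.cos (phiA N k)) (Real.sin (phiA N k)) := h
      rwa [← h']
    simp only [mem_slopeL] at h'
    have h0 := h' (0, Real.cos (phiA N j)) (by simp)
    have h1 := h' (1, Real.cos (phiA N j) + Real.sin (phiA N j)) (by simp)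
    simp at h0 h1
    ext
    exact phi_inj N hN j k j.2 k.2 h0 (by linarith)
  · intro j i h
    simp only [slopeL, vertL, AffineSubspace.direction_mk'] at h
    have h1 : ((1 : ℝ), Real.sin (phiA N j)) ∈ Submodule.span ℝ {((0 : ℝ), (1 : ℝ))} := by
      rw [← h]
      exact Submodule.mem_span_singleton_self _
    rw [Submodule.mem_span_singleton] at h1
    obtain ⟨c, hc⟩ := h1
    simpa using congrArg Prod.fst hc
  · intro i
    have hsub : (⋃ j : Fin (2 * N), ((vertL (Real.tan (thetaA N i)) : Set (ℝ × ℝ)) ∩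
        (slopeL (Real.cos (phiA N j)) (Real.sin (phiA N j)) : Set (ℝ × ℝ)))) ⊆
        (((Finset.range N).image
          (fun k => (Real.tan (thetaA N i), hgt N i (2 * k))) : Finset (ℝ × ℝ)) : Set (ℝ × ℝ)) := by
      intro p hp
      obtain ⟨j, hp1, hp2⟩ := Set.mem_iUnion.mp hp
      rw [SetLike.mem_coe, mem_vertL] at hp1
      rw [SetLike.mem_coe, mem_slopeL, hp1] at hp2
      have hp3 : p.2 = hgt N i j := hp2
      have : ∃ k < N, hgt N i j = hgt N i (2 * k) := by
        by_cases hj : Even (j : ℕ)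
        · obtain ⟨k, hk⟩ := hj
          refine ⟨k, by omega, ?_⟩
          rw [hk, two_mul]
        · exact hgt_refl N hN i j i.2 j.2 hj
      obtain ⟨k, hk, e⟩ := this
      rw [Finset.mem_coe, Finset.mem_image]
      exact ⟨k, Finset.mem_range.mpr hk, Prod.ext hp1.symm (by simp [hp3, e])⟩
    refine (Set.ncard_le_ncard hsub (Finset.finite_toSet _)).trans ?_
    rw [Set.ncard_coe_finset]
    exact Finset.card_image_le.trans (by simp)
end
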